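/- For every 1 < p < ∞, H^{1,p}_atb(μ) = H^{1,∞}_atb(μ) with equivalent norms: there is a constant C ≥ 1, depending only on p, d, n, C₀ and β_d, such that every f ∈ H^{1,p}_atb(μ) belongs to H^{1,∞}_atb(μ) with ‖f‖_{H^{1,∞}_atb(μ)} ≤ C·‖f‖_{H^{1,p}_atb(μ)}, and conversely every f ∈ H^{1,∞}_atb(μ) belongs to H^{1,p}_atb(μ) with ‖f‖_{H^{1,p}_atb(μ)} ≤ C·‖f‖_{H^{1,∞}_atb(μ)}. -/

import Mathlib

/-!
Common definitions for formalizing Tolsa, "BMO, H¹, and Calderón–Zygmund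
operators for non doubling measures".
-/

open MeasureTheory Metric Set Function
open scoped Classical
open scoped ENNReal NNReal BigOperators

noncomputable section

/-- `ℝ^d` with the Euclidean metric. -/
abbrev Euc (d : ℕ) := EuclideanSpace ℝ (Fin d)

variable {d : ℕ}

/-- The support of a measure: points all of whose balls have positive measure. -/
def measSupp (μ : MeasureTheory.Measure (Euc d)) : Set (Euc d) :=
  {x | ∀ r : ℝ, 0 < r → 0 < μ (Metric.ball x r)}

/-- The growth condition `μ(B(x,r)) ≤ C₀ rⁿ`. -/
def GrowthBound (μ : MeasureTheory.Measure (Euc d)) (n : ℕ) (C₀ : ℝ) : Prop :=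
  ∀ (x : Euc d) (r : ℝ), 0 < r → μ (Metric.ball x r) ≤ ENNReal.ofReal (C₀ * r ^ n)

/-- A (closed, axis-parallel) cube with center in the support of `μ` and positive
side length. -/
structure CubeOf (μ : MeasureTheory.Measure (Euc d)) where
  c : Euc d
  ℓ : ℝ
  ℓ_pos : 0 < ℓ
  c_mem : c ∈ measSupp μ

namespace CubeOf

variable {μ : MeasureTheory.Measure (Euc d)}

/-- The set of points of a cube. -/
def set (Q : CubeOf μ) : Set (Euc d) := {y | ∀ i, |y i - Q.c i| ≤ Q.ℓ / 2}

/-- The concentric dilation `aQ` of a cube, as a set. -/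
def dil (Q : CubeOf μ) (a : ℝ) : Set (Euc d) := {y | ∀ i, |y i - Q.c i| ≤ a * Q.ℓ / 2}

/-- The cube `2^k Q`. -/
def pow2 (Q : CubeOf μ) (k : ℕ) : CubeOf μ :=
  ⟨Q.c, 2 ^ k * Q.ℓ, mul_pos (by positivity) Q.ℓ_pos, Q.c_mem⟩

/-- The cube `6^k Q`. -/
def pow6 (Q : CubeOf μ) (k : ℕ) : CubeOf μ :=
  ⟨Q.c, 6 ^ k * Q.ℓ, mul_pos (by positivity) Q.ℓ_pos, Q.c_mem⟩

end CubeOf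

/-- `(α,β)`-doubling cube: `μ(αQ) ≤ β μ(Q)`. -/
def IsDoubling (μ : MeasureTheory.Measure (Euc d)) (α β : ℝ) (Q : CubeOf μ) : Prop :=
  μ (Q.dil α) ≤ ENNReal.ofReal β * μ Q.set

/-- `N_{Q,R}`: the first integer `k ≥ 1` such that `l(2^k Q) ≥ l(R)`. -/
def NQR {μ : MeasureTheory.Measure (Euc d)} (Q R : CubeOf μ) : ℕ :=
  sInf {k : ℕ | 1 ≤ k ∧ R.ℓ ≤ 2 ^ k * Q.ℓ}

/-- The coefficient `K_{Q,R} = 1 + ∑_{k=1}^{N_{Q,R}} μ(2^k Q)/l(2^k Q)^n`. -/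
def Kcoef {μ : MeasureTheory.Measure (Euc d)} (n : ℕ) (Q R : CubeOf μ) : ℝ :=
  1 + ∑ k ∈ Finset.Icc 1 (NQR Q R), (μ ((Q.pow2 k).set)).toReal / ((2 ^ k * Q.ℓ) ^ n)

/-- The smallest `N ≥ 0` such that `2^N Q` is `(2,βd)`-doubling. -/
def tildeIdx (μ : MeasureTheory.Measure (Euc d)) (βd : ℝ) (Q : CubeOf μ) : ℕ :=
  sInf {N : ℕ | IsDoubling μ 2 βd (Q.pow2 N)}

/-- The cube `Q̃`: the smallest cube `2^N Q`, `N ≥ 0`, which is `(2,βd)`-doubling. -/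
def CubeOf.tilde {μ : MeasureTheory.Measure (Euc d)} (Q : CubeOf μ) (βd : ℝ) : CubeOf μ :=
  Q.pow2 (tildeIdx μ βd Q)

/-- The mean `m_Q f` of `f` over the cube `Q` with respect to `μ`. -/
def mQ (μ : MeasureTheory.Measure (Euc d)) (Q : CubeOf μ) (f : Euc d → ℝ) : ℝ :=
  ⨍ x in Q.set, f x ∂μ

/-- For `μ`-a.e. `x` there are `(2,βd)`-doubling cubes centered at `x` of arbitrarily
small side length. -/
def SmallDoublingAE (μ : MeasureTheory.Measure (Euc d)) (βd : ℝ) : Prop :=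
  ∀ᵐ x ∂μ, ∀ ℓ₀ : ℝ, 0 < ℓ₀ → ∃ Q : CubeOf μ, Q.c = x ∧ Q.ℓ < ℓ₀ ∧ IsDoubling μ 2 βd Q

/-- `C` is an admissible constant in the definition of the `RBMO(μ)` norm of `f`. -/
def RBMOBoundWith (μ : MeasureTheory.Measure (Euc d)) (n : ℕ) (βd : ℝ)
    (f : Euc d → ℝ) (C : ℝ≥0∞) : Prop :=
  (∀ Q : CubeOf μ,
    ∫⁻ x in Q.set, ENNReal.ofReal |f x - mQ μ (Q.tilde βd) f| ∂μ ≤ C * μ (Q.dil 2)) ∧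
  (∀ Q R : CubeOf μ, Q.set ⊆ R.set → IsDoubling μ 2 βd Q → IsDoubling μ 2 βd R →
    ENNReal.ofReal |mQ μ Q f - mQ μ R f| ≤ C * ENNReal.ofReal (Kcoef n Q R))

/-- The `RBMO(μ)` norm `‖f‖_*` (with value `∞` if `f ∉ RBMO(μ)`). -/
def rbmoNorm (μ : MeasureTheory.Measure (Euc d)) (n : ℕ) (βd : ℝ) (f : Euc d → ℝ) : ℝ≥0∞ :=
  sInf {C | RBMOBoundWith μ n βd f C}

/-- The conditions defining `‖f‖_{**,(ρ)}`, for a given family of numbers `fQ`. -/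
def StarStarBoundWith (μ : MeasureTheory.Measure (Euc d)) (n : ℕ) (ρ : ℝ)
    (f : Euc d → ℝ) (fQ : CubeOf μ → ℝ) (C : ℝ≥0∞) : Prop :=
  (∀ Q : CubeOf μ, ∫⁻ x in Q.set, ENNReal.ofReal |f x - fQ Q| ∂μ ≤ C * μ (Q.dil ρ)) ∧
  (∀ Q R : CubeOf μ, Q.set ⊆ R.set →
    ENNReal.ofReal |fQ Q - fQ R| ≤ C * ENNReal.ofReal (Kcoef n Q R))

/-- The norm `‖f‖_{**,(ρ)}`. -/
def starStarNorm (μ : MeasureTheory.Measure (Euc d)) (n : ℕ) (ρ : ℝ) (f : Euc d → ℝ) : ℝ≥0∞ :=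
  sInf {C | ∃ fQ : CubeOf μ → ℝ, StarStarBoundWith μ n ρ f fQ C}

end

noncomputable section

variable {d : ℕ}

/-- The conditions defining the `RBMO^p(μ)` norm. -/
def RBMOpBoundWith (μ : MeasureTheory.Measure (Euc d)) (n : ℕ) (βd : ℝ) (p : ℝ)
    (f : Euc d → ℝ) (C : ℝ≥0∞) : Prop :=
  (∀ Q : CubeOf μ,
    ∫⁻ x in Q.set, ENNReal.ofReal |f x - mQ μ (Q.tilde βd) f| ^ p ∂μ ≤ C ^ p * μ (Q.dil 2)) ∧
  (∀ Q R : CubeOf μ, Q.set ⊆ R.set → IsDoubling μ 2 βd Q → IsDoubling μ 2 βd R →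
    ENNReal.ofReal |mQ μ Q f - mQ μ R f| ≤ C * ENNReal.ofReal (Kcoef n Q R))

/-- The `RBMO^p(μ)` norm `‖f‖_{*,p}`. -/
def rbmoPNorm (μ : MeasureTheory.Measure (Euc d)) (n : ℕ) (βd : ℝ) (p : ℝ)
    (f : Euc d → ℝ) : ℝ≥0∞ :=
  sInf {C | RBMOpBoundWith μ n βd p f C}

/-- Condition (b) of Lemma `fifi` of the paper, with constant `Cb`. -/
def CondB (μ : MeasureTheory.Measure (Euc d)) (n : ℕ) (ρ : ℝ)
    (f : Euc d → ℝ) (Cb : ℝ≥0∞) : Prop :=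
  (∀ Q : CubeOf μ, ∫⁻ x in Q.set, ENNReal.ofReal |f x - mQ μ Q f| ∂μ ≤ Cb * μ (Q.dil ρ)) ∧
  (∀ Q R : CubeOf μ, Q.set ⊆ R.set →
    ENNReal.ofReal |mQ μ Q f - mQ μ R f| ≤
      Cb * ENNReal.ofReal (Kcoef n Q R) * (μ (Q.dil ρ) / μ Q.set + μ (R.dil ρ) / μ R.set))

/-- Condition (c) of Lemma `fifi` of the paper, with constant `Cc`. -/
def CondC (μ : MeasureTheory.Measure (Euc d)) (n : ℕ) (βd : ℝ)
    (f : Euc d → ℝ) (Cc : ℝ≥0∞) : Prop :=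
  (∀ Q : CubeOf μ, IsDoubling μ 2 βd Q →
    ∫⁻ x in Q.set, ENNReal.ofReal |f x - mQ μ Q f| ∂μ ≤ Cc * μ Q.set) ∧
  (∀ Q R : CubeOf μ, Q.set ⊆ R.set → IsDoubling μ 2 βd Q → IsDoubling μ 2 βd R →
    ENNReal.ofReal |mQ μ Q f - mQ μ R f| ≤ Cc * ENNReal.ofReal (Kcoef n Q R))

/-- The conditions defining the norm `‖f‖_∘`, relative to a choice `αQ` of minimizers. -/
def CircBoundWith (μ : MeasureTheory.Measure (Euc d)) (n : ℕ) (βd : ℝ)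
    (f : Euc d → ℝ) (αQ : CubeOf μ → ℝ) (C : ℝ≥0∞) : Prop :=
  (∀ Q : CubeOf μ,
    ∫⁻ x in Q.set, ENNReal.ofReal |f x - αQ (Q.tilde βd)| ∂μ ≤ C * μ (Q.dil 2)) ∧
  (∀ Q R : CubeOf μ, Q.set ⊆ R.set → IsDoubling μ 2 βd Q → IsDoubling μ 2 βd R →
    ENNReal.ofReal |αQ Q - αQ R| ≤ C * ENNReal.ofReal (Kcoef n Q R))

/-- The norm `‖f‖_∘`, relative to a choice `αQ` of minimizers. -/
def circNorm (μ : MeasureTheory.Measure (Euc d)) (n : ℕ) (βd : ℝ)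
    (f : Euc d → ℝ) (αQ : CubeOf μ → ℝ) : ℝ≥0∞ :=
  sInf {C | CircBoundWith μ n βd f αQ C}

/-- An atomic block: a function supported on a cube `R`, with zero integral, of the
form `b = ∑ λⱼ aⱼ` with `aⱼ` supported on cubes `Qⱼ ⊆ R` and
`‖aⱼ‖_{L∞(μ)} ≤ (μ(2Qⱼ) K_{Qⱼ,R})⁻¹`. -/
structure AtomicBlock (μ : MeasureTheory.Measure (Euc d)) (n : ℕ) where
  b : Euc d → ℝ
  R : CubeOf μ
  lam : ℕ → ℝ
  a : ℕ → Euc d → ℝ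
  Qj : ℕ → CubeOf μ
  integrable : MeasureTheory.Integrable b μ
  supp_b : ∀ x ∉ R.set, b x = 0
  int_zero : ∫ x, b x ∂μ = 0
  Qj_sub : ∀ j, (Qj j).set ⊆ R.set
  a_supp : ∀ j, ∀ x ∉ (Qj j).set, a j x = 0
  a_meas : ∀ j, MeasureTheory.AEStronglyMeasurable (a j) μ
  a_bound : ∀ j, MeasureTheory.eLpNorm (a j) ⊤ μ ≤
    (μ ((Qj j).dil 2) * ENNReal.ofReal (Kcoef n (Qj j) R))⁻¹
  lam_summable : Summable fun j => |lam j|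
  b_eq : ∀ᵐ x ∂μ, HasSum (fun j => lam j * a j x) (b x)

/-- `|b|_{H^{1,∞}_atb(μ)} = ∑ⱼ |λⱼ|` for the given decomposition. -/
def AtomicBlock.size {μ : MeasureTheory.Measure (Euc d)} {n : ℕ}
    (B : AtomicBlock μ n) : ℝ :=
  ∑' j, |B.lam j|

/-- The `H^{1,∞}_atb(μ)` norm (with value `∞` outside the space). -/
def hatbNorm (μ : MeasureTheory.Measure (Euc d)) (n : ℕ) (f : Euc d → ℝ) : ℝ≥0∞ :=
  sInf {t : ℝ≥0∞ | ∃ B : ℕ → AtomicBlock μ n,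
    (∀ᵐ x ∂μ, HasSum (fun i => (B i).b x) (f x)) ∧
    t = ∑' i, ENNReal.ofReal ((B i).size)}

/-- A `p`-atomic block: like an atomic block, but with the size condition
`‖aⱼ‖_{L^p(μ)} ≤ μ(2Qⱼ)^{1/p-1} K_{Qⱼ,R}⁻¹`. -/
structure PAtomicBlock (μ : MeasureTheory.Measure (Euc d)) (n : ℕ) (p : ℝ) where
  b : Euc d → ℝ
  R : CubeOf μ
  lam : ℕ → ℝ
  a : ℕ → Euc d → ℝ
  Qj : ℕ → CubeOf μ
  integrable : MeasureTheory.Integrable b μ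
  supp_b : ∀ x ∉ R.set, b x = 0
  int_zero : ∫ x, b x ∂μ = 0
  Qj_sub : ∀ j, (Qj j).set ⊆ R.set
  a_supp : ∀ j, ∀ x ∉ (Qj j).set, a j x = 0
  a_meas : ∀ j, MeasureTheory.AEStronglyMeasurable (a j) μ
  a_bound : ∀ j, MeasureTheory.eLpNorm (a j) (ENNReal.ofReal p) μ ≤
    μ ((Qj j).dil 2) ^ (1 / p - 1) * (ENNReal.ofReal (Kcoef n (Qj j) R))⁻¹
  lam_summable : Summable fun j => |lam j|
  b_eq : ∀ᵐ x ∂μ, HasSum (fun j => lam j * a j x) (b x)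

/-- `|b|_{H^{1,p}_atb(μ)} = ∑ⱼ |λⱼ|` for the given decomposition. -/
def PAtomicBlock.size {μ : MeasureTheory.Measure (Euc d)} {n : ℕ} {p : ℝ}
    (B : PAtomicBlock μ n p) : ℝ :=
  ∑' j, |B.lam j|

/-- The `H^{1,p}_atb(μ)` norm (with value `∞` outside the space). -/
def hatbPNorm (μ : MeasureTheory.Measure (Euc d)) (n : ℕ) (p : ℝ) (f : Euc d → ℝ) : ℝ≥0∞ :=
  sInf {t : ℝ≥0∞ | ∃ B : ℕ → PAtomicBlock μ n p,
    (∀ᵐ x ∂μ, HasSum (fun i => (B i).b x) (f x)) ∧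
    t = ∑' i, ENNReal.ofReal ((B i).size)}

/-- A Calderón–Zygmund kernel of dimension `n`, with constant `Ck` and Hölder
exponent `δ`. -/
def CZKernelBound (n : ℕ) (k : Euc d → Euc d → ℝ) (Ck δ : ℝ) : Prop :=
  (∀ x y : Euc d, x ≠ y → |k x y| ≤ Ck / dist x y ^ (n : ℝ)) ∧
  (∀ x x' y : Euc d, x ≠ y → dist x x' ≤ dist x y / 2 →
    |k x y - k x' y| + |k y x - k y x'| ≤ Ck * dist x x' ^ δ / dist x y ^ ((n : ℝ) + δ))

/-- The truncated operator `T_ε f(x) = ∫_{|x-y|>ε} k(x,y) f(y) dμ(y)`. -/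
def trunc (μ : MeasureTheory.Measure (Euc d)) (k : Euc d → Euc d → ℝ) (ε : ℝ)
    (f : Euc d → ℝ) (x : Euc d) : ℝ :=
  ∫ y in {y | ε < dist x y}, k x y * f y ∂μ

/-- The non-centered doubling maximal operator `N`. -/
def Nop (μ : MeasureTheory.Measure (Euc d)) (βd : ℝ) (f : Euc d → ℝ) (x : Euc d) : ℝ≥0∞ :=
  ⨆ (Q : CubeOf μ) (_ : x ∈ Q.set) (_ : IsDoubling μ 2 βd Q),
    (∫⁻ y in Q.set, ENNReal.ofReal |f y| ∂μ) / μ Q.set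

/-- The sharp maximal operator `M^♯`. -/
def Msharp (μ : MeasureTheory.Measure (Euc d)) (n : ℕ) (βd : ℝ)
    (f : Euc d → ℝ) (x : Euc d) : ℝ≥0∞ :=
  (⨆ (Q : CubeOf μ) (_ : x ∈ Q.set),
    (∫⁻ y in Q.set, ENNReal.ofReal |f y - mQ μ (Q.tilde βd) f| ∂μ) / μ (Q.dil (3/2))) +
  ⨆ (Q : CubeOf μ) (R : CubeOf μ) (_ : x ∈ Q.set) (_ : Q.set ⊆ R.set)
      (_ : IsDoubling μ 2 βd Q) (_ : IsDoubling μ 2 βd R),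
    ENNReal.ofReal (|mQ μ Q f - mQ μ R f| / Kcoef n Q R)

/-- The weight functions `w_i = χ_{Q_i} / ∑_k χ_{Q_k}` of the Calderón–Zygmund
decomposition. -/
def czWeight {μ : MeasureTheory.Measure (Euc d)} (J : Finset ℕ) (Q : ℕ → CubeOf μ)
    (i : ℕ) (x : Euc d) : ℝ :=
  Set.indicator (Q i).set
    (fun y => (((J.filter fun kk => y ∈ (Q kk).set).card : ℝ))⁻¹) x

/-- The smallest `(6,6^{n+1})`-doubling cube of the form `6^k Q`, `k ≥ 1`. -/
def smallest6Doubling (μ : MeasureTheory.Measure (Euc d)) (n : ℕ) (Q : CubeOf μ) : CubeOf μ :=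
  Q.pow6 (sInf {k : ℕ | 1 ≤ k ∧ IsDoubling μ 6 (6 ^ (n + 1)) (Q.pow6 k)})

end

open MeasureTheory Metric Set Function
open scoped Classical
open scoped ENNReal NNReal BigOperators

namespace TolsaAux

variable {d : ℕ}

/-- cube with center `x` and side `t` -/
def cube (x : Euc d) (t : ℝ) : Set (Euc d) := {y | ∀ i, |y i - x i| ≤ t / 2}

theorem cube_mono (x : Euc d) {t t' : ℝ} (h : t ≤ t') : cube x t ⊆ cube x t' := by
  intro y hy i
  have := hy i
  linarith

theorem mem_cube_self (x : Euc d) {t : ℝ} (h : 0 ≤ t) : x ∈ cube x t := by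
  intro i; simp; linarith

theorem mem_cube_comm {x y : Euc d} {t : ℝ} (h : x ∈ cube y t) : y ∈ cube x t := by
  intro i; rw [abs_sub_comm]; exact h i

theorem cube_subset {x y : Euc d} {r t t' : ℝ} (h : x ∈ cube y r) (h' : r + t ≤ t') :
    cube x t ⊆ cube y t' := by
  intro z hz i
  have h1 := hz i
  have h2 := h i
  have := abs_sub_le (z i) (x i) (y i)
  linarith

theorem isClosed_cube (x : Euc d) (t : ℝ) : IsClosed (cube x t) := by
  have : cube x t = ⋂ i, {y : Euc d | |y i - x i| ≤ t / 2} := by ext; simp [cube]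
  rw [this]
  refine isClosed_iInter fun i => isClosed_le ?_ continuous_const
  fun_prop

theorem measurableSet_cube (x : Euc d) (t : ℝ) : MeasurableSet (cube x t) :=
  (isClosed_cube x t).measurableSet

theorem ball_subset_cube (x : Euc d) (t : ℝ) : Metric.ball x (t / 2) ⊆ cube x t := by
  intro y hy i
  have h1 : ‖(y - x) i‖ ≤ ‖y - x‖ := PiLp.norm_apply_le (y - x) i
  rw [Metric.mem_ball, dist_eq_norm] at hy
  simp only [PiLp.sub_apply, Real.norm_eq_abs] at h1
  linarith

theorem cube_subset_ball (hd : 1 ≤ d) (x : Euc d) {t : ℝ} (ht : 0 < t) :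
    cube x t ⊆ Metric.ball x (d * t) := by
  intro y hy
  rw [Metric.mem_ball, EuclideanSpace.dist_eq]
  have hd' : (1 : ℝ) ≤ d := by exact_mod_cast hd
  rw [Real.sqrt_lt' (by positivity)]
  have : ∑ i, dist (y i) (x i) ^ 2 ≤ ∑ _i : Fin d, (t / 2) ^ 2 := by
    refine Finset.sum_le_sum fun i _ => ?_
    rw [Real.dist_eq]
    exact pow_le_pow_left₀ (abs_nonneg _) (hy i) 2
  simp at this
  have ht2 : 0 < t ^ 2 := by positivity
  nlinarith [mul_pos ht2 (by linarith : (0 : ℝ) < d), mul_le_mul_of_nonneg_right hd' (mul_pos ht2 (by linarith : (0 : ℝ) < d)).le]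

theorem side_le_of_subset (hd : 1 ≤ d) {x y : Euc d} {t t' : ℝ} (ht : 0 ≤ t)
    (h : cube x t ⊆ cube y t') : t ≤ t' := by
  have i : Fin d := ⟨0, hd⟩
  have h1 : (WithLp.toLp 2 (fun j => x j + t / 2) : Euc d) ∈ cube x t := by
    intro j; simp [abs_of_nonneg (show 0 ≤ t / 2 by linarith)]
  have h2 : (WithLp.toLp 2 (fun j => x j - t / 2) : Euc d) ∈ cube x t := by
    intro j; simp [abs_of_nonneg (show 0 ≤ t / 2 by linarith)]
  have h1 := abs_le.1 (h h1 i)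
  have h2 := abs_le.1 (h h2 i)
  simp at h1 h2
  linarith

/-- packaged growth hypothesis -/
structure Grow (μ : Measure (Euc d)) (n : ℕ) (C : ℝ) : Prop where
  hn : 1 ≤ n
  hnd : n ≤ d
  hC : 1 ≤ C
  bd : ∀ (x : Euc d) (t : ℝ), 0 < t → μ (cube x t) ≤ ENNReal.ofReal (C * t ^ n)

variable {μ : Measure (Euc d)} {n : ℕ} {C : ℝ}

theorem Grow.of_growthBound {C₀ : ℝ} (hn : 1 ≤ n) (hnd : n ≤ d) (hC₀ : 0 < C₀)
    (h : GrowthBound μ n C₀) : Grow μ n (C₀ * d ^ n + 1) := by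
  refine ⟨hn, hnd, by have : 0 ≤ C₀ * d ^ n := by positivity
                      linarith, fun x t ht => ?_⟩
  have hd : 1 ≤ d := hn.trans hnd
  have hd' : (1 : ℝ) ≤ d := by exact_mod_cast hd
  refine (measure_mono (cube_subset_ball hd x ht)).trans ((h x (d * t) (by positivity)).trans ?_)
  apply ENNReal.ofReal_le_ofReal
  have : 0 < t ^ n := by positivity
  rw [mul_pow]
  nlinarith

theorem Grow.fin (h : Grow μ n C) (x : Euc d) (t : ℝ) : μ (cube x t) ≠ ∞ := by
  refine ne_top_of_le_ne_top ENNReal.ofReal_ne_top ((measure_mono (cube_mono x (le_max_left t 1))).trans (h.bd x _ (lt_max_of_lt_right one_pos)))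

theorem Grow.real (h : Grow μ n C) (x : Euc d) {t : ℝ} (ht : 0 < t) :
    μ.real (cube x t) ≤ C * t ^ n := by
  have := h.hC
  exact ENNReal.toReal_le_of_le_ofReal (by positivity) (h.bd x t ht)

theorem Grow.locFin (h : Grow μ n C) : IsLocallyFiniteMeasure μ := by
  refine ⟨fun x => ⟨cube x 2, ?_, (h.fin x 2).lt_top⟩⟩
  refine Filter.mem_of_superset (Metric.ball_mem_nhds x one_pos) ?_
  have := ball_subset_cube x 2
  simpa using this

theorem Grow.mono_real (h : Grow μ n C) {s : Set (Euc d)} {x : Euc d} {t : ℝ}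
    (hs : s ⊆ cube x t) : μ.real s ≤ μ.real (cube x t) :=
  measureReal_mono hs (h.fin x t)

theorem Grow.pos (h : Grow μ n C) {x : Euc d} (hx : x ∈ measSupp μ) {t : ℝ} (ht : 0 < t) :
    0 < μ.real (cube x t) := by
  rw [Measure.real, ENNReal.toReal_pos_iff]
  exact ⟨(hx (t / 2) (by linarith)).trans_le (measure_mono (ball_subset_cube x t)),
    (h.fin x t).lt_top⟩

/-- doubling -/
def Dbl (μ : Measure (Euc d)) (x : Euc d) (t : ℝ) : Prop :=
  μ.real (cube x (32 * t)) ≤ 32 ^ (d + 1) * μ.real (cube x t)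

theorem Grow.not_dbl (h : Grow μ n C) {x : Euc d} {t : ℝ} (hd : ¬ Dbl μ x t) :
    32 ^ (n + 1) * μ.real (cube x t) ≤ μ.real (cube x (32 * t)) := by
  rw [Dbl, not_le] at hd
  refine le_trans ?_ hd.le
  have : (32 : ℝ) ^ (n + 1) ≤ 32 ^ (d + 1) := pow_le_pow_right₀ (by norm_num) (by have := h.hnd; omega)
  exact mul_le_mul_of_nonneg_right this measureReal_nonneg

/-- along nondoubling scales the density `μ(r)/r^{n+1}` increases -/
theorem Grow.chain (h : Grow μ n C) {x : Euc d} {t : ℝ} {j m : ℕ} (hjm : j ≤ m)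
    (hd : ∀ i, j ≤ i → i < m → ¬ Dbl μ x (32 ^ i * t)) :
    (32 ^ (n + 1)) ^ (m - j) * μ.real (cube x (32 ^ j * t)) ≤ μ.real (cube x (32 ^ m * t)) := by
  induction m, hjm using Nat.le_induction with
  | base => simp
  | succ m hm ih =>
    have h1 := ih fun i hi hi' => hd i hi (by omega)
    have h2 := h.not_dbl (hd m hm (by omega))
    rw [Nat.succ_sub hm, pow_succ, show (32 : ℝ) ^ (m + 1) * t = 32 * (32 ^ m * t) by ring]
    refine le_trans ?_ h2
    rw [mul_comm ((32 ^ (n + 1)) ^ (m - j)), mul_assoc]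
    gcongr

theorem Grow.exists_dbl (h : Grow μ n C) {x : Euc d} (hx : x ∈ measSupp μ) {t : ℝ} (ht : 0 < t) :
    ∃ m : ℕ, 1 ≤ m ∧ Dbl μ x (32 ^ m * t) := by
  by_contra! hcon
  have key : ∀ m : ℕ, (32 : ℝ) ^ m * μ.real (cube x (32 * t)) ≤ C * (32 * t) ^ n := by
    intro m
    have h1 := h.chain (x := x) (t := t) (j := 1) (m := m + 1) (by omega) (fun i hi _ => hcon i hi)
    have h2 := h.real x (t := 32 ^ (m + 1) * t) (by positivity)
    have h3 := h1.trans h2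
    simp only [Nat.add_sub_cancel, pow_one] at h3
    have e1 : ((32 : ℝ) ^ (n + 1)) ^ m = (32 ^ m) ^ n * 32 ^ m := by
      rw [← pow_mul, ← pow_mul, ← pow_add]; congr 1; ring
    have e2 : C * (32 ^ (m + 1) * t) ^ n = (32 ^ m) ^ n * (C * (32 * t) ^ n) := by
      rw [pow_succ, mul_assoc, mul_pow]; ring
    rw [e1, e2, mul_assoc] at h3
    exact le_of_mul_le_mul_left h3 (by positivity)
  have hp := h.pos hx (t := 32 * t) (by positivity)
  obtain ⟨m, hm⟩ := pow_unbounded_of_one_lt (C * (32 * t) ^ n / μ.real (cube x (32 * t)))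
    (by norm_num : (1 : ℝ) < 32)
  rw [div_lt_iff₀ hp] at hm
  exact absurd (key m) (not_le.2 hm)

theorem Grow.lemG (h : Grow μ n C) {x : Euc d} {t : ℝ} (ht : 0 < t) {m : ℕ}
    (hd : ∀ i, 1 ≤ i → i < m → ¬ Dbl μ x (32 ^ i * t)) {r : ℝ} (hr : t < r) :
    μ.real (cube x r) / r ^ n ≤ C * 32 ^ (n + 1) * (r / (32 ^ m * t)) := by
  have hC := h.hC
  have hr0 : 0 < r := ht.trans hr
  rw [div_le_iff₀ (by positivity)]
  have h32 : (1 : ℝ) ≤ 32 ^ (n + 1) := one_le_pow₀ (by norm_num)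
  rcases le_or_gt r (32 ^ m * t) with hle | hgt
  · -- find j
    have hex : ∃ j : ℕ, r ≤ 32 ^ j * t := ⟨m, hle⟩
    have hj := Nat.find_spec hex
    set j := Nat.find hex with hjdef
    have hj1 : 1 ≤ j := by
      rcases Nat.eq_zero_or_pos j with h0 | h0
      · rw [h0] at hj; simp at hj; linarith
      · exact h0
    have hjm : j ≤ m := Nat.find_min' hex hle
    have hj' : 32 ^ (j - 1) * t < r := by
      have := Nat.find_min hex (m := j - 1) (by omega)
      simpa using this
    have h1 := h.chain (x := x) (t := t) hjm (fun i hi hi' => hd i (by omega) hi')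
    have h2 := h.real x (t := 32 ^ m * t) (by positivity)
    have h3 := h.mono_real (cube_mono x hj)
    have h4 : (32 : ℝ) ^ j * t ≤ 32 * r := by
      have : (32 : ℝ) ^ j = 32 * 32 ^ (j - 1) := by
        rw [← pow_succ']; congr 1; omega
      rw [this]; nlinarith
    set T := (32 : ℝ) ^ m * t with hT
    have hT0 : 0 < T := by positivity
    have e : ((32 : ℝ) ^ (n + 1)) ^ (m - j) * (32 ^ j * t) ^ (n + 1) = T ^ (n + 1) := by
      rw [← pow_mul, mul_comm (n + 1), pow_mul, ← mul_pow, ← mul_assoc, ← pow_add,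
        Nat.sub_add_cancel hjm]
    set q := ((32 : ℝ) ^ (n + 1)) ^ (m - j) with hq
    have hq0 : 0 < q := by positivity
    have h5 : ((32 : ℝ) ^ j * t) ^ (n + 1) ≤ (32 * r) ^ (n + 1) :=
      pow_le_pow_left₀ (by positivity) h4 _
    have h6 : q * μ.real (cube x r) ≤ C * T ^ n := by
      refine le_trans ?_ (h1.trans h2)
      gcongr
    have h7 : T ^ (n + 1) ≤ q * (32 * r) ^ (n + 1) := by
      rw [← e]; gcongr
    have h8 : q * μ.real (cube x r) ≤ q * (C * 32 ^ (n + 1) * (r / T) * r ^ n) := by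
      refine h6.trans ?_
      have : C * T ^ n = C * T ^ (n + 1) / T := by rw [pow_succ]; field_simp
      rw [this]
      have e3 : q * (C * 32 ^ (n + 1) * (r / T) * r ^ n) = C * (q * (32 * r) ^ (n + 1)) / T := by
        rw [mul_pow]; ring
      rw [e3]
      gcongr
    exact le_of_mul_le_mul_left h8 hq0
  · have h1 := h.real x hr0
    have h2 : 1 ≤ r / (32 ^ m * t) := by
      rw [le_div_iff₀ (by positivity)]; linarith
    refine h1.trans ?_
    have : C * 1 * 1 * r ^ n ≤ C * 32 ^ (n + 1) * (r / (32 ^ m * t)) * r ^ n := by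
      gcongr
    simpa using this

/-! ### The coefficients `K` -/

theorem NQR_spec (Q R : CubeOf μ) : 1 ≤ NQR Q R ∧ R.ℓ ≤ 2 ^ (NQR Q R) * Q.ℓ := by
  have hne : {k : ℕ | 1 ≤ k ∧ R.ℓ ≤ 2 ^ k * Q.ℓ}.Nonempty := by
    obtain ⟨k, hk⟩ := pow_unbounded_of_one_lt (R.ℓ / Q.ℓ) (by norm_num : (1 : ℝ) < 2)
    refine ⟨k + 1, by omega, ?_⟩
    rw [div_lt_iff₀ Q.ℓ_pos] at hk
    have := Q.ℓ_pos
    rw [pow_succ]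
    have h2 : (0 : ℝ) < 2 ^ k * Q.ℓ := by positivity
    nlinarith
  exact Nat.sInf_mem hne

theorem NQR_le {Q R : CubeOf μ} {k : ℕ} (hk : 1 ≤ k) (h : R.ℓ ≤ 2 ^ k * Q.ℓ) : NQR Q R ≤ k :=
  Nat.sInf_le ⟨hk, h⟩

theorem NQR_upper (Q R : CubeOf μ) : 2 ^ (NQR Q R) * Q.ℓ ≤ 2 * max Q.ℓ R.ℓ := by
  have h := NQR_spec Q R
  rcases Nat.lt_or_ge 1 (NQR Q R) with h1 | h1
  · have h2 : ¬ (R.ℓ ≤ 2 ^ (NQR Q R - 1) * Q.ℓ) := by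
      intro hc
      have := NQR_le (by omega) hc
      omega
    have e : (2 : ℝ) ^ (NQR Q R) = 2 * 2 ^ (NQR Q R - 1) := by
      rw [← pow_succ']; congr 1; omega
    rw [e]
    have := le_max_right Q.ℓ R.ℓ
    linarith
  · have : NQR Q R = 1 := by omega
    rw [this, pow_one]
    have := le_max_left Q.ℓ R.ℓ
    linarith

theorem Kcoef_eq (Q R : CubeOf μ) : Kcoef n Q R =
    1 + ∑ k ∈ Finset.Icc 1 (NQR Q R), μ.real (cube Q.c (2 ^ k * Q.ℓ)) / ((2 ^ k * Q.ℓ) ^ n) := rfl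

theorem one_le_K (Q R : CubeOf μ) : 1 ≤ Kcoef n Q R := by
  rw [Kcoef_eq]
  have : 0 ≤ ∑ k ∈ Finset.Icc 1 (NQR Q R), μ.real (cube Q.c (2 ^ k * Q.ℓ)) / ((2 ^ k * Q.ℓ) ^ n) :=
    Finset.sum_nonneg fun k _ => div_nonneg measureReal_nonneg
      (pow_nonneg (mul_nonneg (by positivity) Q.ℓ_pos.le) _)
  linarith

theorem Grow.theta (h : Grow μ n C) (x : Euc d) {t : ℝ} (ht : 0 < t) :
    μ.real (cube x t) / t ^ n ≤ C := by
  rw [div_le_iff₀ (by positivity)]; exact h.real x ht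

theorem Grow.K_comparable (h : Grow μ n C) {Q R : CubeOf μ} (hR : R.ℓ ≤ 4 * Q.ℓ) :
    Kcoef n Q R ≤ 1 + 2 * C := by
  have hN : NQR Q R ≤ 2 := NQR_le (by norm_num) (by linarith)
  have hQ := Q.ℓ_pos
  have hC := h.hC
  rw [Kcoef_eq]
  have : ∑ k ∈ Finset.Icc 1 (NQR Q R), μ.real (cube Q.c (2 ^ k * Q.ℓ)) / ((2 ^ k * Q.ℓ) ^ n)
      ≤ ∑ k ∈ Finset.Icc 1 (NQR Q R), C :=
    Finset.sum_le_sum fun k _ => h.theta _ (by positivity)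
  rw [Finset.sum_const, Nat.card_Icc, nsmul_eq_mul] at this
  have h2 : ((NQR Q R + 1 - 1 : ℕ) : ℝ) ≤ 2 := by
    rw [Nat.add_sub_cancel]; exact_mod_cast hN
  nlinarith

theorem sum_geom_bound (N : ℕ) : ∑ k ∈ Finset.Icc 1 N, (2 : ℝ) ^ k ≤ 2 * 2 ^ N := by
  induction N with
  | zero => simp
  | succ N ih => rw [Finset.sum_Icc_succ_top (by omega), pow_succ]; nlinarith [pow_pos (two_pos : (0:ℝ) < 2) N]

theorem Grow.K_geom (_h : Grow μ n C) {Q S : CubeOf μ} {T c : ℝ} (hc : 0 ≤ c)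
    (hQS : Q.ℓ ≤ S.ℓ) (hST : S.ℓ ≤ T)
    (hth : ∀ r, Q.ℓ < r → μ.real (cube Q.c r) / r ^ n ≤ c * (r / T)) :
    Kcoef n Q S ≤ 1 + 4 * c := by
  have hQ := Q.ℓ_pos
  have hT : 0 < T := by linarith
  rw [Kcoef_eq]
  have : ∑ k ∈ Finset.Icc 1 (NQR Q S), μ.real (cube Q.c (2 ^ k * Q.ℓ)) / ((2 ^ k * Q.ℓ) ^ n)
      ≤ ∑ k ∈ Finset.Icc 1 (NQR Q S), c * Q.ℓ / T * 2 ^ k := by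
    refine Finset.sum_le_sum fun k hk => (hth _ ?_).trans (le_of_eq (by ring))
    have : (2 : ℝ) ^ 1 ≤ 2 ^ k := pow_le_pow_right₀ (by norm_num) (Finset.mem_Icc.1 hk).1
    nlinarith
  rw [← Finset.mul_sum] at this
  have h2 := sum_geom_bound (NQR Q S)
  have h3 := NQR_upper Q S
  rw [max_eq_right hQS] at h3
  have h4 : c * Q.ℓ / T * ∑ k ∈ Finset.Icc 1 (NQR Q S), (2 : ℝ) ^ k ≤ c * Q.ℓ / T * (2 * 2 ^ NQR Q S) := by
    gcongr
  have h5 : c * Q.ℓ / T * (2 * 2 ^ NQR Q S) = 2 * c * (2 ^ NQR Q S * Q.ℓ) / T := by ring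
  have h6 : 2 * c * (2 ^ NQR Q S * Q.ℓ) / T ≤ 4 * c := by
    rw [div_le_iff₀ hT]
    have : 2 ^ NQR Q S * Q.ℓ ≤ 2 * T := by linarith
    nlinarith
  linarith

/-- quasi-triangle inequality -/
theorem Grow.K_triangle (h : Grow μ n C) {Q' Q D : CubeOf μ} (hc : Q'.c ∈ cube Q.c Q.ℓ)
    (hl : Q'.ℓ ≤ 2 * Q.ℓ) : Kcoef n Q' D ≤ Kcoef n Q' Q + 8 ^ n * (3 * C + 1) * Kcoef n Q D := by
  have hQ := Q.ℓ_pos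
  have hQ' := Q'.ℓ_pos
  have hC := h.hC
  obtain ⟨hk1, hk1'⟩ := NQR_spec Q' Q
  have hk2 := NQR_upper Q' Q
  obtain ⟨hN1, hN1'⟩ := NQR_spec Q D
  set k1 := NQR Q' Q with hk1def
  set N := NQR Q D with hNdef
  set N' := NQR Q' D with hN'def
  have hk2' : 2 ^ k1 * Q'.ℓ ≤ 4 * Q.ℓ := by
    have : max Q'.ℓ Q.ℓ ≤ 2 * Q.ℓ := max_le hl (by linarith)
    linarith
  have hNN : N' ≤ k1 + N := by
    refine NQR_le (by omega) (hN1'.trans ?_)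
    rw [pow_add]
    have : (0 : ℝ) < 2 ^ N := by positivity
    nlinarith
  set f' : ℕ → ℝ := fun k => μ.real (cube Q'.c (2 ^ k * Q'.ℓ)) / ((2 ^ k * Q'.ℓ) ^ n) with hf'
  set f : ℕ → ℝ := fun k => μ.real (cube Q.c (2 ^ k * Q.ℓ)) / ((2 ^ k * Q.ℓ) ^ n) with hf
  have hf'0 : ∀ k, 0 ≤ f' k := fun k => div_nonneg measureReal_nonneg (by positivity)
  have hf0 : ∀ k, 0 ≤ f k := fun k => div_nonneg measureReal_nonneg (by positivity)
  have hfC : ∀ k, f k ≤ C := fun k => h.theta _ (by positivity)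
  have hmain : ∀ j, f' (k1 + j) ≤ 8 ^ n * f (j + 3) := by
    intro j
    have hsub : cube Q'.c (2 ^ (k1 + j) * Q'.ℓ) ⊆ cube Q.c (2 ^ (j + 3) * Q.ℓ) := by
      refine cube_subset hc ?_
      have h1 : (1 : ℝ) ≤ 2 ^ j := one_le_pow₀ (by norm_num)
      rw [pow_add, pow_add]
      have : (2 : ℝ) ^ k1 * 2 ^ j * Q'.ℓ ≤ 2 ^ j * (4 * Q.ℓ) := by nlinarith
      nlinarith
    have h1 := h.mono_real hsub
    have h2 : (2 ^ j * Q.ℓ) ≤ 2 ^ (k1 + j) * Q'.ℓ := by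
      rw [pow_add]
      have : (0 : ℝ) < 2 ^ j := by positivity
      nlinarith
    have e : 8 ^ n * f (j + 3) = μ.real (cube Q.c (2 ^ (j + 3) * Q.ℓ)) / (2 ^ j * Q.ℓ) ^ n := by
      simp only [hf]
      have : (2 : ℝ) ^ (j + 3) * Q.ℓ = 8 * (2 ^ j * Q.ℓ) := by ring
      rw [this, mul_pow 8]
      field_simp
    rw [e]
    simp only [hf']
    gcongr
  rw [Kcoef_eq, Kcoef_eq, Kcoef_eq]
  change 1 + ∑ k ∈ Finset.Icc 1 N', f' k ≤ 1 + ∑ k ∈ Finset.Icc 1 k1, f' k +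
    8 ^ n * (3 * C + 1) * (1 + ∑ k ∈ Finset.Icc 1 N, f k)
  have s1 : ∑ k ∈ Finset.Icc 1 N', f' k ≤ ∑ k ∈ Finset.Icc 1 (k1 + N), f' k :=
    Finset.sum_le_sum_of_subset_of_nonneg (Finset.Icc_subset_Icc_right hNN) fun k _ _ => hf'0 k
  have s2 : ∑ k ∈ Finset.Icc 1 (k1 + N), f' k = ∑ k ∈ Finset.Icc 1 k1, f' k +
      ∑ j ∈ Finset.Icc 1 N, f' (k1 + j) := by
    clear_value N
    clear hNN s1 hN1 hN1' hNdef
    induction N with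
    | zero => simp
    | succ N ih =>
      rw [Finset.sum_Icc_succ_top (by omega : 1 ≤ N + 1), ← add_assoc, Finset.sum_Icc_succ_top (by omega), ih, add_assoc, add_assoc]
  have s3 : ∑ j ∈ Finset.Icc 1 N, f' (k1 + j) ≤ 8 ^ n * ∑ j ∈ Finset.Icc 1 N, f (j + 3) := by
    rw [Finset.mul_sum]; exact Finset.sum_le_sum fun j _ => hmain j
  have s4 : ∑ j ∈ Finset.Icc 1 N, f (j + 3) ≤ ∑ k ∈ Finset.Icc 1 N, f k + 3 * C := by
    clear_value N
    clear hNN s1 hN1 hN1' hNdef s2 s3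
    have : ∑ j ∈ Finset.Icc 1 N, f (j + 3) + (f 1 + f 2 + f 3) = ∑ k ∈ Finset.Icc 1 N, f k + (f (N + 1) + f (N + 2) + f (N + 3)) := by
      induction N with
      | zero => simp
      | succ N ih =>
        rw [Finset.sum_Icc_succ_top (by omega), Finset.sum_Icc_succ_top (by omega)]
        have e1 : N + 1 + 1 = N + 2 := rfl
        have e2 : N + 1 + 2 = N + 3 := rfl
        rw [e1, e2]
        linarith
    have := hfC (N + 1); have := hfC (N + 2); have := hfC (N + 3)
    have := hf0 1; have := hf0 2; have := hf0 3
    linarith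
  set S := ∑ k ∈ Finset.Icc 1 N, f k
  have hS : 0 ≤ S := Finset.sum_nonneg fun k _ => hf0 k
  have s5 : 8 ^ n * ∑ j ∈ Finset.Icc 1 N, f (j + 3) ≤ 8 ^ n * ((3 * C + 1) * (1 + S)) := by
    have : ∑ j ∈ Finset.Icc 1 N, f (j + 3) ≤ (3 * C + 1) * (1 + S) := by nlinarith
    gcongr
  linarith

end TolsaAux

open MeasureTheory Metric Set Function
open scoped Classical
open scoped ENNReal NNReal BigOperators

namespace TolsaAux

variable {d : ℕ}
variable {μ : Measure (Euc d)} {n : ℕ} {C : ℝ}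

/-- coordinates -/
def eqv (d : ℕ) : Euc d ≃ᵐ (Fin d → ℝ) := (MeasurableEquiv.toLp 2 (Fin d → ℝ)).symm

theorem eqv_apply (x : Euc d) (i : Fin d) : eqv d x i = x i := rfl

theorem eqv_symm_apply (x : Fin d → ℝ) (i : Fin d) : (eqv d).symm x i = x i := rfl

theorem preimage_closedBall (x : Euc d) {r : ℝ} (hr : 0 ≤ r) :
    eqv d ⁻¹' (closedBall (eqv d x) r) = cube x (2 * r) := by
  ext y
  rw [mem_preimage, mem_closedBall, dist_pi_le_iff hr]
  simp only [cube, mem_setOf_eq, Real.dist_eq, eqv_apply]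
  constructor <;> intro h i <;> have := h i <;> linarith

theorem map_closedBall (ρ : Measure (Euc d)) (x : Euc d) {r : ℝ} (hr : 0 ≤ r) :
    ρ.map (eqv d) (closedBall (eqv d x) r) = ρ (cube x (2 * r)) := by
  rw [MeasurableEquiv.map_apply, preimage_closedBall x hr]

theorem Grow.locFin_map (h : Grow μ n C) : IsLocallyFiniteMeasure (μ.map (eqv d)) := by
  refine ⟨fun x => ⟨closedBall x 1, closedBall_mem_nhds _ one_pos, ?_⟩⟩
  have := map_closedBall μ ((eqv d).symm x) (zero_le_one)
  rw [MeasurableEquiv.apply_symm_apply] at this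
  rw [this]
  exact (h.fin _ _).lt_top

theorem tendsto_half : Filter.Tendsto (fun t : ℝ => t / 2) (nhdsWithin 0 (Ioi 0)) (nhdsWithin 0 (Ioi 0)) := by
  refine tendsto_nhdsWithin_iff.2 ⟨?_, ?_⟩
  · have : Filter.Tendsto (fun t : ℝ => t / 2) (nhds 0) (nhds (0 / 2)) := by
      exact Filter.tendsto_id.div_const 2
    rw [zero_div] at this
    exact this.mono_left nhdsWithin_le_nhds
  · filter_upwards [self_mem_nhdsWithin] with t ht
    simp only [mem_Ioi] at *
    linarith

theorem Grow.ae_lebesgue (h : Grow μ n C) {g : Euc d → ℝ≥0∞} (hg : Measurable g)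
    (hfin : ∫⁻ x, g x ∂μ ≠ ∞) :
    ∀ᵐ x ∂μ, Filter.Tendsto (fun t => (∫⁻ y in cube x t, g y ∂μ) / μ (cube x t))
      (nhdsWithin 0 (Ioi 0)) (nhds (g x)) := by
  haveI := h.locFin_map
  have hg' : Measurable (fun y => g ((eqv d).symm y)) := hg.comp (eqv d).symm.measurable
  have e1 : ∫⁻ y, g ((eqv d).symm y) ∂(μ.map (eqv d)) = ∫⁻ x, g x ∂μ := by
    rw [lintegral_map_equiv]; simp
  have key := (Besicovitch.vitaliFamily (μ.map (eqv d))).ae_tendsto_lintegral_div' hg' (by rw [e1]; exact hfin)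
  have key2 := MeasureTheory.ae_of_ae_map (eqv d).measurable.aemeasurable key
  filter_upwards [key2] with x hx
  have h3 := (hx.comp (Besicovitch.tendsto_filterAt (μ.map (eqv d)) (eqv d x))).comp tendsto_half
  rw [MeasurableEquiv.symm_apply_apply] at h3
  refine h3.congr' ?_
  filter_upwards [self_mem_nhdsWithin] with t ht
  have ht : 0 < t := ht
  simp only [Function.comp]
  rw [map_closedBall _ _ (by linarith), setLIntegral_map measurableSet_closedBall hg' (eqv d).measurable,
    preimage_closedBall _ (by linarith), show 2 * (t / 2) = t by ring]
  simp

theorem Grow.ae_supp_vol (h : Grow μ n C) :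
    ∀ᵐ x ∂μ, x ∈ measSupp μ ∧ ∃ M : ℝ, 0 < M ∧ ∃ ε : ℝ, 0 < ε ∧ ∀ t : ℝ, 0 < t → t < ε →
      t ^ d ≤ M * μ.real (cube x t) := by
  haveI := h.locFin_map
  have hd : 1 ≤ d := h.hn.trans h.hnd
  have k1 := (Besicovitch.vitaliFamily (μ.map (eqv d))).ae_eventually_measure_pos
  have k2 := Besicovitch.ae_tendsto_rnDeriv (volume : Measure (Fin d → ℝ)) (μ.map (eqv d))
  have k3 := Measure.rnDeriv_lt_top (volume : Measure (Fin d → ℝ)) (μ.map (eqv d))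
  have k1' := MeasureTheory.ae_of_ae_map (eqv d).measurable.aemeasurable k1
  have k2' := MeasureTheory.ae_of_ae_map (eqv d).measurable.aemeasurable k2
  have k3' := MeasureTheory.ae_of_ae_map (eqv d).measurable.aemeasurable k3
  filter_upwards [k1', k2', k3'] with x h1 h2 h3
  have h1 := (Besicovitch.tendsto_filterAt (μ.map (eqv d)) (eqv d x)).eventually h1
  have pos : ∀ t : ℝ, 0 < t → 0 < μ (cube x t) := by
    intro t ht
    have h4 : ∀ᶠ r in nhdsWithin (0 : ℝ) (Ioi 0), r < t / 2 :=
      Filter.Eventually.filter_mono nhdsWithin_le_nhds (gt_mem_nhds (by linarith))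
    obtain ⟨r, hr, hr2, hr3⟩ := (h1.and (h4.and self_mem_nhdsWithin)).exists
    have hr3 : 0 < r := hr3
    rw [map_closedBall _ _ hr3.le] at hr
    exact hr.trans_le (measure_mono (cube_mono x (by linarith)))
  refine ⟨?_, ?_⟩
  · intro r hr
    have hd' : (0 : ℝ) < d := by exact_mod_cast hd
    refine (pos (r / d) (by positivity)).trans_le (measure_mono ?_)
    have := cube_subset_ball hd x (t := r / d) (by positivity)
    rwa [mul_div_cancel₀ _ hd'.ne'] at this
  · set L := (volume : Measure (Fin d → ℝ)).rnDeriv (μ.map (eqv d)) (eqv d x) with hL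
    have hLM : L < ENNReal.ofReal (L.toReal + 1) := by
      rw [ENNReal.lt_ofReal_iff_toReal_lt h3.ne]; linarith
    have h5 := h2.eventually (gt_mem_nhds hLM)
    rw [eventually_nhdsWithin_iff, Metric.eventually_nhds_iff] at h5
    obtain ⟨ε, hε, h5⟩ := h5
    refine ⟨L.toReal + 1, by positivity, ε, hε, fun t ht hte => ?_⟩
    have h6 := h5 (y := t / 2) (by rw [Real.dist_eq, sub_zero, abs_of_pos (by linarith)]; linarith) (by simp only [mem_Ioi]; linarith)
    rw [map_closedBall _ _ (by linarith), Real.volume_pi_closedBall _ (by linarith), show 2 * (t / 2) = t by ring] at h6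
    have hpos := pos t ht
    have h7 := (ENNReal.div_le_iff hpos.ne' (h.fin x t)).1 h6.le
    rw [Fintype.card_fin] at h7
    have h8 := ENNReal.toReal_mono (ENNReal.mul_ne_top ENNReal.ofReal_ne_top (h.fin x t)) h7
    rw [ENNReal.toReal_mul, ENNReal.toReal_ofReal (by positivity), ENNReal.toReal_ofReal (by positivity)] at h8
    exact h8

theorem Grow.ae_small (h : Grow μ n C) :
    ∀ᵐ x ∂μ, x ∈ measSupp μ ∧ ∀ ε : ℝ, 0 < ε → ∃ t, 0 < t ∧ t < ε ∧ Dbl μ x t := by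
  filter_upwards [h.ae_supp_vol] with x ⟨hx, M, hM, ε0, hε0, hvol⟩
  refine ⟨hx, fun ε hε => ?_⟩
  by_contra! hcon
  set t0 := min ε ε0 / 2 with ht0
  have hm : 0 < min ε ε0 := lt_min hε hε0
  have ht0p : 0 < t0 := by positivity
  have ht0e : t0 < ε := by have := min_le_left ε ε0; linarith
  have ht0e' : t0 < ε0 := by have := min_le_right ε ε0; linarith
  -- decay
  have dec : ∀ k : ℕ, (32 ^ (d + 1)) ^ k * μ.real (cube x (t0 / 32 ^ k)) ≤ μ.real (cube x t0) := by
    intro k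
    induction k with
    | zero => simp
    | succ k ih =>
      have h32 : (1 : ℝ) ≤ 32 ^ (k + 1) := one_le_pow₀ (by norm_num)
      have h1 := hcon (t0 / 32 ^ (k + 1)) (by positivity) ((div_le_self ht0p.le h32).trans_lt ht0e)
      rw [Dbl, not_le, show 32 * (t0 / 32 ^ (k + 1)) = t0 / 32 ^ k by rw [pow_succ]; field_simp] at h1
      refine le_trans ?_ ih
      rw [pow_succ, mul_assoc]
      gcongr
  have key : ∀ k : ℕ, (32 : ℝ) ^ k * t0 ^ d ≤ M * μ.real (cube x t0) := by
    intro k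
    have h32 : (1 : ℝ) ≤ 32 ^ k := one_le_pow₀ (by norm_num)
    have h1 := hvol (t0 / 32 ^ k) (by positivity) ((div_le_self ht0p.le h32).trans_lt ht0e')
    have h2 := dec k
    have e : (32 : ℝ) ^ k * t0 ^ d = (32 ^ (d + 1)) ^ k * (t0 / 32 ^ k) ^ d := by
      rw [div_pow t0, ← pow_mul, ← pow_mul, add_mul, one_mul, pow_add, mul_comm k d]
      field_simp
    rw [e]
    calc _ ≤ (32 ^ (d + 1)) ^ k * (M * μ.real (cube x (t0 / 32 ^ k))) := by gcongr
      _ = M * ((32 ^ (d + 1)) ^ k * μ.real (cube x (t0 / 32 ^ k))) := by ring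
      _ ≤ _ := by gcongr
  obtain ⟨k, hk⟩ := pow_unbounded_of_one_lt (M * μ.real (cube x t0) / t0 ^ d) (by norm_num : (1 : ℝ) < 32)
  rw [div_lt_iff₀ (by positivity)] at hk
  exact absurd (key k) (not_le.2 hk)

/-- The covering number. -/
theorem covering (d : ℕ) : ∃ N : ℕ, ∀ (ν : Measure (Euc d)) [IsFiniteMeasure ν] (s : Set (Euc d))
    (r : Euc d → ℝ) (L : ℝ), (∀ x ∈ s, 0 < r x) → (∀ x ∈ s, r x ≤ L) →
    ∃ t : Finset (Euc d), ↑t ⊆ s ∧ ν (s \ ⋃ x ∈ t, cube x (r x)) ≤ N / (N + 1) * ν s ∧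
      (t : Set (Euc d)).PairwiseDisjoint fun x => cube x (r x) := by
  obtain ⟨N, τ, hτ, hN⟩ := HasBesicovitchCovering.no_satelliteConfig (α := Fin d → ℝ)
  refine ⟨N, fun ν _ s r L hpos hle => ?_⟩
  rcases s.eq_empty_or_nonempty with rfl | ⟨x0, hx0⟩
  · exact ⟨∅, by simp, by simp, by simp⟩
  have hL : 0 < L := (hpos x0 hx0).trans_le (hle x0 hx0)
  -- scaled coordinates
  let sc : (Fin d → ℝ) ≃ᵐ (Fin d → ℝ) := (Homeomorph.smulOfNeZero (L⁻¹) (inv_ne_zero hL.ne')).toMeasurableEquiv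
  let e : Euc d ≃ᵐ (Fin d → ℝ) := (eqv d).trans sc
  have he : ∀ x i, e x i = L⁻¹ * x i := fun x i => rfl
  have pre : ∀ (x : Euc d) (ρ : ℝ), 0 ≤ ρ → e ⁻¹' (closedBall (e x) (ρ / (2 * L))) = cube x ρ := by
    intro x ρ hρ
    ext y
    rw [mem_preimage, mem_closedBall, dist_pi_le_iff (by positivity)]
    simp only [cube, mem_setOf_eq, Real.dist_eq, he, ← mul_sub, abs_mul, abs_of_pos (inv_pos.2 hL)]
    refine forall_congr' fun i => ?_
    rw [inv_mul_le_iff₀ hL]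
    have : L * (ρ / (2 * L)) = ρ / 2 := by field_simp
    rw [this]
  haveI : IsFiniteMeasure (ν.map e) := Measure.isFiniteMeasure_map ν e
  obtain ⟨t', ht's, ht'ν, ht'd⟩ := Besicovitch.exist_finset_disjoint_balls_large_measure (ν.map e) hτ hN
    (e '' s) (fun y => r (e.symm y) / (2 * L))
    (by rintro _ ⟨x, hx, rfl⟩
        have := hpos x hx
        simp only [MeasurableEquiv.symm_apply_apply]; positivity)
    (by rintro _ ⟨x, hx, rfl⟩
        have := hle x hx
        simp only [MeasurableEquiv.symm_apply_apply]
        rw [div_le_one (by positivity)]; linarith)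
  have hmem : ∀ y ∈ t', e.symm y ∈ s := by
    intro y hy
    obtain ⟨x, hx, rfl⟩ := ht's hy
    simpa using hx
  have hcb : ∀ y ∈ t', e ⁻¹' (closedBall y (r (e.symm y) / (2 * L))) = cube (e.symm y) (r (e.symm y)) := by
    intro y hy
    have := pre (e.symm y) (r (e.symm y)) (hpos _ (hmem y hy)).le
    rwa [MeasurableEquiv.apply_symm_apply] at this
  refine ⟨t'.image e.symm, ?_, ?_, ?_⟩
  · intro x hx
    simp only [Finset.coe_image, mem_image] at hx
    obtain ⟨y, hy, rfl⟩ := hx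
    exact hmem y hy
  · rw [MeasurableEquiv.map_apply, MeasurableEquiv.map_apply, preimage_diff, preimage_image_eq _ e.injective] at ht'ν
    convert ht'ν using 3
    rw [preimage_iUnion₂, Finset.set_biUnion_finset_image]
    exact iUnion₂_congr fun y hy => (hcb y hy).symm
  · intro x hx x' hx' hne
    simp only [Finset.coe_image, mem_image] at hx hx'
    obtain ⟨y, hy, rfl⟩ := hx
    obtain ⟨y', hy', rfl⟩ := hx'
    have := ht'd hy hy' (fun h => hne (by rw [h]))
    simp only [Function.onFun] at this ⊢
    rw [← hcb y hy, ← hcb y' hy']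
    exact this.preimage e

end TolsaAux

open MeasureTheory Metric Set Function
open scoped Classical
open scoped ENNReal NNReal BigOperators

namespace TolsaAux

variable {d : ℕ}
variable {μ : Measure (Euc d)} {n : ℕ} {C : ℝ}

/-- trivial block -/
noncomputable def zeroBlock (n : ℕ) (Q : CubeOf μ) : AtomicBlock μ n where
  b := 0
  R := Q
  lam := 0
  a := 0
  Qj := fun _ => Q
  integrable := integrable_zero _ _ _
  supp_b := fun _ _ => rfl
  int_zero := by simp
  Qj_sub := fun _ => subset_rfl
  a_supp := fun _ _ _ => rfl
  a_meas := fun _ => aestronglyMeasurable_zero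
  a_bound := fun _ => by simp
  lam_summable := by simpa using summable_zero
  b_eq := by
    refine Filter.Eventually.of_forall fun x => ?_
    simpa using hasSum_zero

theorem zeroBlock_size (n : ℕ) (Q : CubeOf μ) : (zeroBlock n Q).size = 0 := by
  simp [AtomicBlock.size, zeroBlock]

theorem hatb_le {f : Euc d → ℝ} (B : ℕ → AtomicBlock μ n)
    (hB : ∀ᵐ x ∂μ, HasSum (fun i => (B i).b x) (f x)) :
    hatbNorm μ n f ≤ ∑' i, ENNReal.ofReal ((B i).size) := sInf_le ⟨B, hB, rfl⟩

theorem hatb_exists {f : Euc d → ℝ} {t : ℝ≥0∞} (h : hatbNorm μ n f < t) :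
    ∃ B : ℕ → AtomicBlock μ n, (∀ᵐ x ∂μ, HasSum (fun i => (B i).b x) (f x)) ∧
      ∑' i, ENNReal.ofReal ((B i).size) < t := by
  obtain ⟨s, ⟨B, hB, rfl⟩, hs⟩ := sInf_lt_iff.1 h
  exact ⟨B, hB, hs⟩

theorem hatb_congr {f g : Euc d → ℝ} (h : f =ᵐ[μ] g) : hatbNorm μ n f = hatbNorm μ n g := by
  have key : ∀ {f g : Euc d → ℝ}, f =ᵐ[μ] g → hatbNorm μ n f ≤ hatbNorm μ n g := by
    intro f g h
    refine le_sInf ?_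
    rintro t ⟨B, hB, rfl⟩
    refine hatb_le B ?_
    filter_upwards [hB, h] with x hx hx2
    rw [hx2]; exact hx
  exact le_antisymm (key h) (key h.symm)

theorem hatb_block (B : AtomicBlock μ n) : hatbNorm μ n B.b ≤ ENNReal.ofReal B.size := by
  have := hatb_le (f := B.b) (fun i => if i = 0 then B else zeroBlock n B.R) (by
    refine Filter.Eventually.of_forall fun x => ?_
    have := hasSum_ite_eq (0 : ℕ) (B.b x)
    convert this using 2 with i
    by_cases hi : i = 0
    · simp [hi]
    · simp [hi, zeroBlock])
  refine this.trans ?_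
  rw [tsum_eq_single 0]
  · simp
  · intro i hi; simp [hi, zeroBlock_size]

theorem hatb_zero (Q : CubeOf μ) : hatbNorm μ n (fun _ => (0 : ℝ)) = 0 := by
  have := hatb_block (zeroBlock n Q)
  rw [zeroBlock_size, ENNReal.ofReal_zero] at this
  exact le_antisymm this zero_le

theorem enorm_hasSum_le {u : ℕ → ℝ} {s : ℝ} (h : HasSum u s) : ‖s‖ₑ ≤ ∑' j, ‖u j‖ₑ := by
  rw [← h.tsum_eq]
  exact enorm_tsum_le_tsum_enorm

theorem block_int (h : Grow μ n C) (B : AtomicBlock μ n) :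
    ∫⁻ x, ‖B.b x‖ₑ ∂μ ≤ ENNReal.ofReal B.size := by
  have hd : 1 ≤ d := h.hn.trans h.hnd
  have h1 : ∀ j, ∫⁻ x, ‖B.a j x‖ₑ ∂μ ≤ 1 := by
    intro j
    have hQ : MeasurableSet (B.Qj j).set := measurableSet_cube _ _
    have e1 : ∫⁻ x, ‖B.a j x‖ₑ ∂μ = ∫⁻ x in (B.Qj j).set, ‖B.a j x‖ₑ ∂μ := by
      rw [← lintegral_indicator hQ]
      refine lintegral_congr fun x => ?_
      by_cases hx : x ∈ (B.Qj j).set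
      · rw [indicator_of_mem hx]
      · rw [indicator_of_notMem hx, B.a_supp j x hx, enorm_zero]
    have e2 : ∀ᵐ x ∂(μ.restrict (B.Qj j).set), ‖B.a j x‖ₑ ≤ (μ ((B.Qj j).dil 2))⁻¹ := by
      refine ae_restrict_of_ae ?_
      have := ae_le_eLpNormEssSup (f := B.a j) (μ := μ)
      filter_upwards [this] with x hx
      have hb := B.a_bound j
      rw [eLpNorm_exponent_top] at hb
      refine hx.trans (hb.trans ?_)
      refine ENNReal.inv_le_inv.2 ?_
      conv_lhs => rw [← mul_one (μ _)]
      gcongr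
      rw [← ENNReal.ofReal_one]
      exact ENNReal.ofReal_le_ofReal (one_le_K _ _)
    rw [e1]
    refine (lintegral_mono_ae e2).trans ?_
    rw [lintegral_const, Measure.restrict_apply_univ]
    have hsub : (B.Qj j).set ⊆ (B.Qj j).dil 2 := by
      refine cube_mono _ ?_
      have := (B.Qj j).ℓ_pos
      linarith
    refine (mul_le_mul_right (measure_mono hsub) _).trans ?_
    exact ENNReal.inv_mul_le_one _
  have hl : ∑' j, ‖B.lam j‖ₑ = ENNReal.ofReal B.size := by
    rw [AtomicBlock.size, ENNReal.ofReal_tsum_of_nonneg (fun _ => abs_nonneg _) B.lam_summable]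
    exact tsum_congr fun j => Real.enorm_eq_ofReal_abs _
  have hae : ∀ᵐ x ∂μ, ‖B.b x‖ₑ ≤ ∑' j, ‖B.lam j‖ₑ * ‖B.a j x‖ₑ := by
    filter_upwards [B.b_eq] with x hx
    refine (enorm_hasSum_le hx).trans (le_of_eq (tsum_congr fun j => ?_))
    rw [enorm_mul]
  refine (lintegral_mono_ae hae).trans ?_
  rw [lintegral_tsum (fun j => ((B.a_meas j).enorm.const_mul _)), ← hl]
  refine ENNReal.tsum_le_tsum fun j => ?_
  rw [lintegral_const_mul'' _ (B.a_meas j).enorm]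
  calc _ ≤ ‖B.lam j‖ₑ * 1 := by gcongr; exact h1 j
    _ = _ := mul_one _

theorem hatb_tsum (h : Grow μ n C) (F : ℕ → Euc d → ℝ) (f : Euc d → ℝ)
    (hf : ∀ᵐ x ∂μ, HasSum (fun k => F k x) (f x)) :
    hatbNorm μ n f ≤ ∑' k, hatbNorm μ n (F k) := by
  refine ENNReal.le_of_forall_pos_le_add fun ε hε hfin => ?_
  obtain ⟨ε', hε', hsum⟩ := ENNReal.exists_pos_sum_of_countable (ι := ℕ) (ENNReal.coe_pos.2 hε).ne' 
  have hex : ∀ k, ∃ B : ℕ → AtomicBlock μ n, (∀ᵐ x ∂μ, HasSum (fun i => (B i).b x) (F k x)) ∧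
      ∑' i, ENNReal.ofReal ((B i).size) < hatbNorm μ n (F k) + ε' k := by
    intro k
    refine hatb_exists (ENNReal.lt_add_right ?_ (ENNReal.coe_pos.2 (hε' k)).ne')
    exact ENNReal.ne_top_of_tsum_ne_top hfin.ne k
  choose B hB hBs using hex
  have hT : ∑' q : ℕ × ℕ, ENNReal.ofReal ((B q.1 q.2).size) ≤ ∑' k, hatbNorm μ n (F k) + ε := by
    rw [ENNReal.tsum_prod']
    calc _ ≤ ∑' k, (hatbNorm μ n (F k) + ε' k) := ENNReal.tsum_le_tsum fun k => (hBs k).le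
      _ = _ := ENNReal.tsum_add
      _ ≤ _ := by gcongr
  have hTfin : ∑' q : ℕ × ℕ, ENNReal.ofReal ((B q.1 q.2).size) ≠ ∞ :=
    ne_top_of_le_ne_top (ENNReal.add_ne_top.2 ⟨hfin.ne, ENNReal.coe_ne_top⟩) hT
  refine le_trans ?_ hT
  have hre : ∑' q : ℕ × ℕ, ENNReal.ofReal ((B q.1 q.2).size) =
      ∑' i, ENNReal.ofReal ((B (Nat.pairEquiv.symm i).1 (Nat.pairEquiv.symm i).2).size) := by
    rw [Nat.pairEquiv.symm.tsum_eq (fun q : ℕ × ℕ => ENNReal.ofReal ((B q.1 q.2).size))]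
  rw [hre]
  refine hatb_le (fun i => B (Nat.pairEquiv.symm i).1 (Nat.pairEquiv.symm i).2) ?_
  have hI : ∫⁻ x, ∑' q : ℕ × ℕ, ‖(B q.1 q.2).b x‖ₑ ∂μ ≠ ∞ := by
    rw [lintegral_tsum (fun q : ℕ × ℕ => (B q.1 q.2).integrable.aestronglyMeasurable.enorm)]
    exact ne_top_of_le_ne_top hTfin (ENNReal.tsum_le_tsum fun q => block_int h _)
  have hae := ae_lt_top' (AEMeasurable.tsum (fun q : ℕ × ℕ => (B q.1 q.2).integrable.aestronglyMeasurable.enorm)) hI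
  filter_upwards [hae, hf, ae_all_iff.2 hB] with x hx hfx hBx
  have hs : Summable (fun q : ℕ × ℕ => (B q.1 q.2).b x) := by
    refine Summable.of_norm ?_
    have := ENNReal.tsum_coe_ne_top_iff_summable_coe.1 hx.ne
    exact this
  have h1 := hs.hasSum.prod_fiberwise hBx
  rw [hfx.unique h1]
  exact (Nat.pairEquiv.symm.hasSum_iff (f := fun q : ℕ × ℕ => (B q.1 q.2).b x)).2 hs.hasSum

theorem hatb_nocube (he : IsEmpty (CubeOf μ)) (f : Euc d → ℝ) : hatbNorm μ n f = ∞ := by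
  refine top_le_iff.1 (le_sInf ?_)
  rintro t ⟨B, -⟩
  exact (he.false (B 0).R).elim

theorem hatb_add (h : Grow μ n C) (f g : Euc d → ℝ) :
    hatbNorm μ n (fun x => f x + g x) ≤ hatbNorm μ n f + hatbNorm μ n g := by
  rcases isEmpty_or_nonempty (CubeOf μ) with he | ⟨⟨Q⟩⟩
  · rw [hatb_nocube he f]; simp
  have := hatb_tsum (n := n) h (fun k => if k = 0 then f else if k = 1 then g else fun _ => 0) (fun x => f x + g x) (by
    refine Filter.Eventually.of_forall fun x => ?_
    have := hasSum_sum_of_ne_finset_zero (L := SummationFilter.unconditional ℕ) (s := Finset.range 2) (f := fun k : ℕ => (if k = 0 then f else if k = 1 then g else fun _ => 0) x) (by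
      intro k hk
      have : ¬ k < 2 := fun hh => hk (Finset.mem_range.2 hh)
      have h0 : k ≠ 0 := by omega
      have h1 : k ≠ 1 := by omega
      simp [h0, h1])
    simpa [Finset.sum_range_succ] using this)
  refine this.trans ?_
  rw [tsum_eq_sum (s := Finset.range 2)]
  · simp [Finset.sum_range_succ]
  · intro k hk
    have : ¬ k < 2 := fun hh => hk (Finset.mem_range.2 hh)
    have h0 : k ≠ 0 := by omega
    have h1 : k ≠ 1 := by omega
    simp [h0, h1, hatb_zero Q]

theorem hatb_sum (h : Grow μ n C) (Q : CubeOf μ) {ι : Type*} (t : Finset ι) (F : ι → Euc d → ℝ) :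
    hatbNorm μ n (fun x => ∑ k ∈ t, F k x) ≤ ∑ k ∈ t, hatbNorm μ n (F k) := by
  induction t using Finset.induction_on with
  | empty => simp [hatb_zero Q]
  | insert a s ha ih =>
    simp only [Finset.sum_insert ha]
    exact (hatb_add h _ _).trans (by gcongr)

/-- subtract the mean over `D` -/
noncomputable def Lop (D : CubeOf μ) (a : Euc d → ℝ) : Euc d → ℝ :=
  fun x => a x - (∫ y, a y ∂μ) / μ.real D.set * indicator D.set (fun _ => (1 : ℝ)) x

theorem Grow.integrable_bdd (h : Grow μ n C) {g : Euc d → ℝ} (hg : Measurable g) {x : Euc d} {t M : ℝ}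
    (h0 : ∀ y ∉ cube x t, g y = 0) (hM : ∀ y, |g y| ≤ M) : Integrable g μ := by
  have : IntegrableOn g (cube x t) μ := by
    refine Measure.integrableOn_of_bounded (M := M) (h.fin x t) hg.aestronglyMeasurable ?_
    exact Filter.Eventually.of_forall hM
  rw [← integrable_indicator_iff (measurableSet_cube x t)] at this
  refine this.congr (Filter.Eventually.of_forall fun y => ?_)
  by_cases hy : y ∈ cube x t
  · rw [indicator_of_mem hy]
  · rw [indicator_of_notMem hy, h0 y hy]

theorem Grow.int_abs_bdd (h : Grow μ n C) {g : Euc d → ℝ} {x : Euc d} {t M : ℝ} 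
    (h0 : ∀ y ∉ cube x t, g y = 0) (hM : ∀ y, |g y| ≤ M) : |∫ y, g y ∂μ| ≤ M * μ.real (cube x t) := by
  have e : ∫ y, g y ∂μ = ∫ y in cube x t, g y ∂μ := by
    rw [setIntegral_eq_integral_of_forall_compl_eq_zero h0]
  rw [e]
  exact norm_setIntegral_le_of_norm_le_const (f := g) (h.fin x t).lt_top (fun y _ => hM y)

theorem Grow.integrable_ind (h : Grow μ n C) (x : Euc d) (t : ℝ) :
    Integrable (indicator (cube x t) (fun _ => (1 : ℝ))) μ := by
  rw [integrable_indicator_iff (measurableSet_cube x t)]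
  exact integrableOn_const (h.fin x t)

theorem Grow.integrable_Lop (h : Grow μ n C) {D : CubeOf μ} {a : Euc d → ℝ} (ha : Integrable a μ) :
    Integrable (Lop D a) μ := ha.sub ((h.integrable_ind D.c D.ℓ).const_mul _)

theorem Grow.int_ind (_h : Grow μ n C) (D : CubeOf μ) :
    ∫ x, indicator D.set (fun _ => (1 : ℝ)) x ∂μ = μ.real D.set := by
  have hD : MeasurableSet D.set := measurableSet_cube D.c D.ℓ
  rw [integral_indicator hD]; simp

theorem Grow.posD (h : Grow μ n C) (D : CubeOf μ) : 0 < μ.real D.set := h.pos D.c_mem D.ℓ_pos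

theorem Grow.int_Lop (h : Grow μ n C) {D : CubeOf μ} {a : Euc d → ℝ} (ha : Integrable a μ) :
    ∫ x, Lop D a x ∂μ = 0 := by
  unfold Lop
  have h2 : Integrable (indicator D.set (fun _ => (1 : ℝ))) μ := h.integrable_ind D.c D.ℓ
  rw [integral_sub ha (h2.const_mul _), integral_const_mul, h.int_ind]
  have := h.posD D
  field_simp; ring

/-- cost of an infinity block -/
noncomputable def Cinf (d : ℕ) (C : ℝ) : ℝ := 1 + 32 ^ (d + 1) * (1 + 2 * C)

theorem Grow.hatb_Lop (h : Grow μ n C) {Q D : CubeOf μ} (hsub : Q.set ⊆ D.set) (hD : Dbl μ D.c D.ℓ)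
    {g : Euc d → ℝ} {M : ℝ} (hg : Measurable g) (h0 : ∀ y ∉ Q.set, g y = 0) (hM : ∀ y, |g y| ≤ M) :
    hatbNorm μ n (Lop D g) ≤
      ENNReal.ofReal (Cinf d C * (M * μ.real (cube Q.c (2 * Q.ℓ)) * Kcoef n Q D)) := by
  have hC := h.hC
  have hM0 : 0 ≤ M := (abs_nonneg _).trans (hM 0)
  have hgi : Integrable g μ := h.integrable_bdd hg h0 hM
  have hm := h.int_abs_bdd h0 hM
  set c0 := (∫ y, g y ∂μ) / μ.real D.set with hc0
  set V := μ.real (cube Q.c (2 * Q.ℓ)) with hV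
  have hVp : 0 < V := h.pos Q.c_mem (by have := Q.ℓ_pos; linarith)
  have hK := one_le_K (n := n) Q D
  have hDp := h.posD D
  have hQV : μ.real (cube Q.c Q.ℓ) ≤ V := h.mono_real (cube_mono _ (by have := Q.ℓ_pos; linarith))
  have hKD : Kcoef n D D ≤ 1 + 2 * C := h.K_comparable (by have := D.ℓ_pos; linarith)
  have hKD1 := one_le_K (n := n) D D
  have h2D : μ.real (cube D.c (2 * D.ℓ)) ≤ 32 ^ (d + 1) * μ.real D.set :=
    (h.mono_real (cube_mono _ (by have := D.ℓ_pos; linarith))).trans hD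
  have h2Dp : 0 < μ.real (cube D.c (2 * D.ℓ)) := h.pos D.c_mem (by have := D.ℓ_pos; linarith)
  set l0 := M * V * Kcoef n Q D with hl0
  set l1 := M * V * (32 ^ (d + 1) * (1 + 2 * C)) with hl1
  have hl0n : 0 ≤ l0 := by positivity
  have hl1n : 0 ≤ l1 := by positivity
  have hz : M = 0 → (∀ y, g y = 0) := fun hz y => by
    have := hM y
    rw [hz] at this
    exact abs_eq_zero.1 (le_antisymm this (abs_nonneg _))
  have hbd : ∀ (Q' : CubeOf μ) (u : Euc d → ℝ) (r : ℝ),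
      (∀ y, |u y| * (μ.real (cube Q'.c (2 * Q'.ℓ)) * Kcoef n Q' D) ≤ 1) → eLpNorm u ⊤ μ ≤
        (μ (Q'.dil 2) * ENNReal.ofReal (Kcoef n Q' D))⁻¹ := by
    intro Q' u r hu
    have hp1 : 0 < μ.real (cube Q'.c (2 * Q'.ℓ)) := h.pos Q'.c_mem (by have := Q'.ℓ_pos; linarith)
    have hp2 := one_le_K (n := n) Q' D
    have e : (μ (Q'.dil 2) * ENNReal.ofReal (Kcoef n Q' D))⁻¹ =
        ENNReal.ofReal ((μ.real (cube Q'.c (2 * Q'.ℓ)) * Kcoef n Q' D)⁻¹) := by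
      rw [ENNReal.ofReal_inv_of_pos (by positivity), ENNReal.ofReal_mul hp1.le, Measure.real,
        ENNReal.ofReal_toReal (h.fin _ _)]
      rfl
    rw [e]
    refine eLpNormEssSup_le_of_ae_bound (Filter.Eventually.of_forall fun y => ?_)
    rw [Real.norm_eq_abs, ← one_div, le_div_iff₀ (by positivity)]
    exact hu y
  have hsm : HasSum (fun j : ℕ => |if j = 0 then l0 else if j = 1 then l1 else 0|) (l0 + l1) := by
    have := hasSum_sum_of_ne_finset_zero (L := SummationFilter.unconditional ℕ) (s := Finset.range 2) (f := fun j : ℕ => |if j = 0 then l0 else if j = 1 then l1 else 0|) (by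
      intro k hk
      have : ¬ k < 2 := fun hh => hk (Finset.mem_range.2 hh)
      have h0 : k ≠ 0 := by omega
      have h1 : k ≠ 1 := by omega
      simp [h0, h1])
    simpa [Finset.sum_range_succ, abs_of_nonneg hl0n, abs_of_nonneg hl1n] using this
  let B : AtomicBlock μ n :=
    { b := Lop D g
      R := D
      lam := fun j => if j = 0 then l0 else if j = 1 then l1 else 0
      a := fun j => if j = 0 then fun x => l0⁻¹ * g x else if j = 1 then
        fun x => - (l1⁻¹ * c0) * indicator D.set (fun _ => (1 : ℝ)) x else fun _ => 0
      Qj := fun j => if j = 0 then Q else D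
      integrable := h.integrable_Lop hgi
      supp_b := fun x hx => by
        rw [Lop, indicator_of_notMem hx, h0 x (fun hx' => hx (hsub hx'))]; simp
      int_zero := h.int_Lop hgi
      Qj_sub := fun j => by
        by_cases hj : j = 0
        · simpa [hj] using hsub
        · simp [hj]
      a_supp := fun j x hx => by
        by_cases hj : j = 0
        · simp only [hj, if_true] at hx ⊢
          rw [h0 x hx, mul_zero]
        · by_cases hj1 : j = 1
          · simp only [hj, hj1, if_true, if_false, one_ne_zero] at hx ⊢
            rw [indicator_of_notMem hx, mul_zero]
          · simp [hj, hj1]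
      a_meas := fun j => by
        by_cases hj : j = 0
        · simp only [hj, if_true]
          exact (hg.const_mul _).aestronglyMeasurable
        · by_cases hj1 : j = 1
          · simp only [hj1, if_true, if_false, one_ne_zero]
            exact ((measurable_const.indicator (measurableSet_cube _ _)).const_mul _).aestronglyMeasurable
          · simp only [hj, hj1, if_false]
            exact aestronglyMeasurable_const
      a_bound := fun j => by
        by_cases hj : j = 0
        · simp only [hj, if_true]
          refine hbd Q _ 0 fun y => ?_
          rw [abs_mul, abs_inv, abs_of_nonneg hl0n]
          rcases hM0.eq_or_lt with hM' | hM'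
          · rw [hz hM'.symm y]; simp
          · have hl0p : 0 < l0 := by positivity
            rw [mul_assoc, inv_mul_le_iff₀ hl0p, mul_one, hl0, mul_assoc M]
            gcongr
            exact hM y
        · by_cases hj1 : j = 1
          · simp only [hj1, if_true, if_false, one_ne_zero]
            refine hbd D _ 0 fun y => ?_
            have hi : |indicator D.set (fun _ => (1 : ℝ)) y| ≤ 1 := by
              by_cases hy : y ∈ D.set
              · rw [indicator_of_mem hy]; simp
              · rw [indicator_of_notMem hy]; simp
            have hc : |c0| * μ.real D.set ≤ M * V := by
              rw [hc0, abs_div, abs_of_pos hDp, div_mul_cancel₀ _ hDp.ne']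
              exact hm.trans (by gcongr)
            rw [abs_mul, abs_neg, abs_mul, abs_inv, abs_of_nonneg hl1n]
            rcases hM0.eq_or_lt with hM' | hM'
            · rw [hl1, ← hM']; simp
            · have hl1p : 0 < l1 := by positivity
              calc l1⁻¹ * |c0| * |indicator D.set (fun _ => (1 : ℝ)) y| * (μ.real (cube D.c (2 * D.ℓ)) * Kcoef n D D)
                  ≤ l1⁻¹ * |c0| * 1 * ((32 ^ (d + 1) * μ.real D.set) * (1 + 2 * C)) := by gcongr
                _ = l1⁻¹ * ((|c0| * μ.real D.set) * (32 ^ (d + 1) * (1 + 2 * C))) := by ring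
                _ ≤ l1⁻¹ * ((M * V) * (32 ^ (d + 1) * (1 + 2 * C))) := by gcongr
                _ = 1 := inv_mul_cancel₀ hl1p.ne'
          · simp only [hj, hj1, if_false]
            rw [eLpNorm_zero']
            exact zero_le
      lam_summable := hsm.summable
      b_eq := by
        refine Filter.Eventually.of_forall fun x => ?_
        have := hasSum_sum_of_ne_finset_zero (L := SummationFilter.unconditional ℕ) (s := Finset.range 2) (f := fun j : ℕ => (if j = 0 then l0 else if j = 1 then l1 else 0) * (if j = 0 then fun x => l0⁻¹ * g x else if j = 1 then
          fun x => - (l1⁻¹ * c0) * indicator D.set (fun _ => (1 : ℝ)) x else fun _ => 0 : Euc d → ℝ) x) (by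
          intro k hk
          have : ¬ k < 2 := fun hh => hk (Finset.mem_range.2 hh)
          have h0 : k ≠ 0 := by omega
          have h1 : k ≠ 1 := by omega
          simp [h0, h1])
        convert this using 1
        simp only [Finset.sum_range_succ, Finset.sum_range_zero, if_true, if_false, one_ne_zero, zero_add]
        rw [Lop, ← hc0]
        rcases hM0.eq_or_lt with hM' | hM'
        · have : c0 = 0 := by
            rw [hc0]; simp [hz hM'.symm]
          rw [hz hM'.symm, this]; simp
        · have hl0p : l0 ≠ 0 := by positivity
          have hl1p : l1 ≠ 0 := by positivity
          field_simp; ring }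
  refine (hatb_block B).trans (ENNReal.ofReal_le_ofReal ?_)
  rw [AtomicBlock.size]
  refine hsm.tsum_eq.le.trans ?_
  rw [Cinf, hl1, add_mul, one_mul]
  have : M * V * (32 ^ (d + 1) * (1 + 2 * C)) = 32 ^ (d + 1) * (1 + 2 * C) * (M * V * 1) := by ring
  rw [this, hl0]
  gcongr

end TolsaAux

open MeasureTheory Metric Set Function
open scoped Classical
open scoped ENNReal NNReal BigOperators

namespace TolsaAux

variable {d : ℕ}
variable {μ : Measure (Euc d)} {n : ℕ} {C p : ℝ}

/-- stopping cubes -/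
theorem Grow.haltCube (h : Grow μ n C) {ν : Measure (Euc d)} [IsFiniteMeasure ν] {Λ : ℝ} (hΛ : 0 < Λ)
    {Q : CubeOf μ} {x : Euc d} (hx : x ∈ measSupp μ) (hxQ : x ∈ Q.set)
    (hsm : ∀ ε : ℝ, 0 < ε → ∃ t, 0 < t ∧ t < ε ∧ Dbl μ x t)
    (hden : ∃ ε : ℝ, 0 < ε ∧ ∀ t, 0 < t → t < ε → Λ * μ.real (cube x t) < ν.real (cube x t))
    (htot : 32 ^ (d + 1) * ν.real univ ≤ Λ * μ.real (cube Q.c (4 * Q.ℓ))) :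
    ∃ P R : CubeOf μ, P.c = x ∧ R.c = x ∧ 2 * P.ℓ < Q.ℓ ∧ 2 * P.ℓ ≤ R.ℓ ∧ Dbl μ x R.ℓ ∧
      (∀ r, P.ℓ < r → μ.real (cube x r) / r ^ n ≤ C * 32 ^ (n + 1) * (r / R.ℓ)) ∧
      Λ * μ.real (cube x (4 * P.ℓ)) ≤ 32 ^ (d + 1) * ν.real (cube x P.ℓ) ∧
      ν.real (cube x (3 * R.ℓ)) ≤ Λ * μ.real (cube x R.ℓ) := by
  obtain ⟨ε, hε, hden⟩ := hden
  obtain ⟨t0, ht0, ht0ε, hdbl⟩ := hsm ε hε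
  have hQ := Q.ℓ_pos
  have hbig : ∀ τ : ℝ, Q.ℓ ≤ 6 * τ →
      32 ^ (d + 1) * ν.real (cube x (3 * τ)) ≤ Λ * μ.real (cube x (32 * τ)) := by
    intro τ hτ
    have h1 : ν.real (cube x (3 * τ)) ≤ ν.real univ := measureReal_mono (subset_univ _)
    have h2 : μ.real (cube Q.c (4 * Q.ℓ)) ≤ μ.real (cube x (32 * τ)) :=
      h.mono_real (cube_subset (mem_cube_comm hxQ) (by linarith))
    calc _ ≤ 32 ^ (d + 1) * ν.real univ := by gcongr
      _ ≤ _ := htot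
      _ ≤ _ := by gcongr
  let S : Set ℕ := {k | Dbl μ x (32 ^ k * t0) ∧
    Λ * μ.real (cube x (32 * (32 ^ k * t0))) < 32 ^ (d + 1) * ν.real (cube x (3 * (32 ^ k * t0)))}
  have h0S : 0 ∈ S := by
    refine ⟨by simpa using hdbl, ?_⟩
    simp only [pow_zero, one_mul]
    have h1 := hden t0 ht0 ht0ε
    have h2 : ν.real (cube x t0) ≤ ν.real (cube x (3 * t0)) :=
      measureReal_mono (cube_mono x (by linarith))
    calc Λ * μ.real (cube x (32 * t0)) ≤ Λ * (32 ^ (d + 1) * μ.real (cube x t0)) := by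
          gcongr; exact hdbl
      _ = 32 ^ (d + 1) * (Λ * μ.real (cube x t0)) := by ring
      _ < 32 ^ (d + 1) * ν.real (cube x t0) := by gcongr
      _ ≤ _ := by gcongr
  have hSlt : ∀ k ∈ S, 6 * (32 ^ k * t0) < Q.ℓ := by
    intro k hk
    by_contra! hc
    exact absurd (hbig _ hc) (not_le.2 hk.2)
  obtain ⟨b, hb⟩ := exists_nat_gt (Q.ℓ / t0)
  have hSb : BddAbove S := by
    refine ⟨b, fun k hk => ?_⟩
    have h1 := hSlt k hk
    have h2 : (k : ℝ) < 32 ^ k := by exact_mod_cast Nat.lt_pow_self (by norm_num)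
    have h3 : (k : ℝ) < b := by
      refine lt_trans ?_ hb
      rw [lt_div_iff₀ ht0]
      have : (k : ℝ) * t0 ≤ 32 ^ k * t0 := by gcongr
      have : 0 < 32 ^ k * t0 := by positivity
      linarith
    exact_mod_cast h3.le
  have hk0 : sSup S ∈ S := Nat.sSup_mem ⟨0, h0S⟩ hSb
  set k0 := sSup S with hk0d
  set ℓ := 32 ^ k0 * t0 with hℓ
  have hℓp : 0 < ℓ := by positivity
  have hex := h.exists_dbl hx hℓp
  set m := Nat.find hex with hm
  have hm1 := (Nat.find_spec hex).1
  have hm2 := (Nat.find_spec hex).2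
  rw [← hm] at hm1 hm2
  have hmm : ∀ i, 1 ≤ i → i < m → ¬ Dbl μ x (32 ^ i * ℓ) := fun i hi him hd =>
    Nat.find_min hex him ⟨hi, hd⟩
  have hfine : 32 ^ (d + 1) * ν.real (cube x (3 * (32 ^ m * ℓ))) ≤ Λ * μ.real (cube x (32 * (32 ^ m * ℓ))) := by
    by_contra! hc
    have e : 32 ^ m * ℓ = 32 ^ (k0 + m) * t0 := by rw [hℓ, pow_add]; ring
    have : k0 + m ∈ S := by
      refine ⟨?_, ?_⟩
      · rw [← e]; exact hm2
      · rw [← e]; exact hc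
    have := le_csSup hSb this
    omega
  have h32 : (32 : ℝ) ≤ 32 ^ m := by
    calc (32 : ℝ) = 32 ^ 1 := by norm_num
      _ ≤ 32 ^ m := pow_le_pow_right₀ (by norm_num) hm1
  have h32ℓ : 32 * ℓ ≤ 32 ^ m * ℓ := by gcongr
  refine ⟨⟨x, 3 * ℓ, by positivity, hx⟩, ⟨x, 32 ^ m * ℓ, by positivity, hx⟩, rfl, rfl, ?_, ?_, hm2, ?_, ?_, ?_⟩
  · have := hSlt k0 hk0
    simp only; linarith
  · simp only; linarith
  · intro r hr
    exact h.lemG hℓp hmm (by simp only at hr; linarith)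
  · simp only
    refine le_trans ?_ hk0.2.le
    refine mul_le_mul_of_nonneg_left ?_ hΛ.le
    exact h.mono_real (cube_mono x (by linarith))
  · simp only
    have := hfine.trans (mul_le_mul_of_nonneg_left hm2 hΛ.le)
    have hb : (0 : ℝ) < 32 ^ (d + 1) := by positivity
    rw [show Λ * (32 ^ (d + 1) * μ.real (cube x (32 ^ m * ℓ))) = 32 ^ (d + 1) * (Λ * μ.real (cube x (32 ^ m * ℓ))) by ring] at this
    exact le_of_mul_le_mul_left this hb

/-- elementary replacement of Hölder -/
theorem abs_le_split {p : ℝ} (hp : 1 < p) {lam : ℝ} (hl : 0 < lam) (a : ℝ) :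
    |a| ≤ lam * (1 + |a| ^ p / lam ^ p) := by
  rcases le_or_gt |a| lam with h1 | h1
  · have : 0 ≤ |a| ^ p / lam ^ p := by positivity
    nlinarith
  · have h2 : 1 ≤ |a| / lam := by rw [one_le_div hl]; exact h1.le
    have h3 : |a| / lam ≤ (|a| / lam) ^ p := Real.self_le_rpow_of_one_le h2 hp.le
    rw [Real.div_rpow (abs_nonneg _) hl.le] at h3
    have h4 : |a| = lam * (|a| / lam) := by field_simp
    calc |a| = lam * (|a| / lam) := h4
      _ ≤ lam * (1 + |a| ^ p / lam ^ p) := by gcongr; linarith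

theorem absInt (hp : 1 < p) {a : Euc d → ℝ} (ha : Measurable a) {E : Set (Euc d)}
    (hi : IntegrableOn (fun x => |a x| ^ p) E μ) (hE : μ E ≠ ∞) : IntegrableOn a E μ := by
  have h1 : IntegrableOn (fun x => 1 * (1 + |a x| ^ p / 1 ^ p)) E μ :=
    ((integrableOn_const hE).add (hi.div_const _)).const_mul _
  refine Integrable.mono' h1 ha.aestronglyMeasurable (Filter.Eventually.of_forall fun x => ?_)
  exact abs_le_split hp one_pos (a x)

theorem absInt_le (hp : 1 < p) {a : Euc d → ℝ} (ha : Measurable a) {E : Set (Euc d)}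
    (hi : IntegrableOn (fun x => |a x| ^ p) E μ) (hE : μ E ≠ ∞) {lam : ℝ} (hl : 0 < lam) :
    ∫ x in E, |a x| ∂μ ≤ lam * (μ.real E + (∫ x in E, |a x| ^ p ∂μ) / lam ^ p) := by
  have h0 : IntegrableOn (fun _ : Euc d => (1 : ℝ)) E μ := integrableOn_const hE
  have h1 : IntegrableOn (fun x => lam * (1 + |a x| ^ p / lam ^ p)) E μ :=
    (h0.add (hi.div_const _)).const_mul _
  refine (integral_mono (absInt hp ha hi hE).abs h1 fun x => abs_le_split hp hl (a x)).trans (le_of_eq ?_)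
  rw [integral_const_mul, integral_add h0 (hi.div_const _), integral_div]
  simp

/-- the spreading functions -/
theorem Grow.spread (h : Grow μ n C) {a : Euc d → ℝ} (hai : Integrable a μ) {r ρ : Euc d → ℝ} {B : ℝ} (hB : 0 < B)
    (t : Finset (Euc d)) :
    (∀ x ∈ t, x ∈ measSupp μ ∧ 0 < r x ∧ r x ≤ ρ x ∧ ∫ y in cube x (3 * ρ x), |a y| ∂μ ≤ B * μ.real (cube x (ρ x))) →
    (t : Set (Euc d)).PairwiseDisjoint (fun x => cube x (r x)) →
    ∃ A : Euc d → Set (Euc d), (∀ x ∈ t, MeasurableSet (A x) ∧ A x ⊆ cube x (ρ x) ∧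
      μ.real (cube x (ρ x)) ≤ 2 * μ.real (A x)) ∧
      ∀ y, ∑ x ∈ t, (∫ z in cube x (r x), |a z| ∂μ) / μ.real (A x) * indicator (A x) (fun _ => (1 : ℝ)) y ≤ 4 * B := by
  induction t using Finset.induction_on_max_value ρ with
  | empty => intro _ _; exact ⟨fun _ => ∅, by simp, fun y => by simp; positivity⟩
  | insert k s hk hmax ih =>
    intro hyp hdis
    obtain ⟨A, hA, hAs⟩ := ih (fun x hx => hyp x (Finset.mem_insert_of_mem hx))
      (hdis.subset (by simp))
    obtain ⟨hkS, hkr, hkρ, hkB⟩ := hyp k (Finset.mem_insert_self _ _)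
    set M : Euc d → ℝ := fun x => ∫ z in cube x (r x), |a z| ∂μ with hM
    have hM0 : ∀ x, 0 ≤ M x := fun x => integral_nonneg fun _ => abs_nonneg _
    set Ψ : Euc d → ℝ := fun y => ∑ x ∈ s, M x / μ.real (A x) * indicator (A x) (fun _ => (1 : ℝ)) y with hΨ
    have hind0 : ∀ (E : Set (Euc d)) y, 0 ≤ indicator E (fun _ => (1 : ℝ)) y :=
      fun E y => indicator_nonneg (fun _ _ => zero_le_one) y
    have hΨ0 : ∀ y, 0 ≤ Ψ y := fun y => Finset.sum_nonneg fun x _ =>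
      mul_nonneg (div_nonneg (hM0 x) measureReal_nonneg) (hind0 _ _)
    have hΨm : Measurable Ψ := by
      refine Finset.measurable_sum s fun x hx => ?_
      exact (measurable_const.indicator (hA x hx).1).const_mul _
    set Rk := cube k (ρ k) with hRk
    have hRm : MeasurableSet Rk := measurableSet_cube _ _
    have hRf : μ Rk ≠ ∞ := h.fin _ _
    have hint : ∀ x ∈ s, ∫ y in Rk, indicator (A x) (fun _ => (1 : ℝ)) y ∂μ = μ.real (A x ∩ Rk) := by
      intro x hx
      rw [integral_indicator (hA x hx).1]
      simp [measureReal_restrict_apply_univ, Measure.restrict_restrict (hA x hx).1]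
    have hinti : ∀ x ∈ s, IntegrableOn (indicator (A x) (fun _ => (1 : ℝ))) Rk μ := by
      intro x hx
      exact (integrableOn_const hRf).indicator (hA x hx).1
    have hΨi : IntegrableOn Ψ Rk μ := by
      refine integrable_finset_sum s fun x hx => (hinti x hx).const_mul _
    have hΨint : ∫ y in Rk, Ψ y ∂μ ≤ B * μ.real Rk := by
      rw [hΨ, integral_finset_sum s (fun x hx => (hinti x hx).const_mul _)]
      have hs1 : ∀ x ∈ s, ∫ y in Rk, M x / μ.real (A x) * indicator (A x) (fun _ => (1 : ℝ)) y ∂μ ≤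
          ∫ z in cube x (r x) ∩ cube k (3 * ρ k), |a z| ∂μ := by
        intro x hx
        rw [integral_const_mul, hint x hx]
        obtain ⟨hxS, hxr, hxρ, hxB⟩ := hyp x (Finset.mem_insert_of_mem hx)
        rcases (A x ∩ Rk).eq_empty_or_nonempty with he | ⟨z, hz1, hz2⟩
        · rw [he]; simp
          exact integral_nonneg fun _ => abs_nonneg _
        · have hsub : cube x (r x) ⊆ cube k (3 * ρ k) := by
            have hz1' := (hA x hx).2.1 hz1
            have h1 : cube z (ρ x + ρ x) ⊆ cube k (3 * ρ k) := cube_subset hz2 (by have := hmax x hx; linarith)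
            refine subset_trans ?_ h1
            exact cube_subset (mem_cube_comm hz1') (by linarith)
          rw [inter_eq_left.2 hsub]
          have hAle : μ.real (A x ∩ Rk) ≤ μ.real (A x) :=
            measureReal_mono inter_subset_left (ne_top_of_le_ne_top (h.fin x (ρ x)) (measure_mono (hA x hx).2.1))
          rw [div_mul_eq_mul_div]
          refine div_le_of_le_mul₀ measureReal_nonneg (hM0 x) ?_
          exact mul_le_mul_of_nonneg_left hAle (hM0 x)
      refine (Finset.sum_le_sum hs1).trans ?_
      rw [← integral_biUnion_finset s (fun x _ => (measurableSet_cube _ _).inter (measurableSet_cube _ _))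
        (fun x hx y hy hxy => (hdis (by simp [Finset.mem_coe.1 hx]) (by simp [Finset.mem_coe.1 hy]) hxy).mono inter_subset_left inter_subset_left)
        (fun x _ => hai.abs.integrableOn)]
      refine le_trans (setIntegral_mono_set hai.abs.integrableOn (Filter.Eventually.of_forall fun _ => abs_nonneg _)
        (LE.le.eventuallyLE ?_)) hkB
      exact iUnion₂_subset fun x _ => inter_subset_right
    have hmark : 2 * B * μ.real (Rk ∩ {y | 2 * B ≤ Ψ y}) ≤ B * μ.real Rk := by
      have := mul_meas_ge_le_integral_of_nonneg (μ := μ.restrict Rk) (Filter.Eventually.of_forall hΨ0) hΨi (2 * B)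
      rw [measureReal_restrict_apply (measurableSet_le measurable_const hΨm), inter_comm] at this
      exact this.trans hΨint
    set E := Rk ∩ {y | 2 * B ≤ Ψ y} with hE
    have hEm : MeasurableSet E := hRm.inter (measurableSet_le measurable_const hΨm)
    have hE2 : 2 * μ.real E ≤ μ.real Rk := by
      have : B * (2 * μ.real E) ≤ B * μ.real Rk := by linarith
      exact le_of_mul_le_mul_left this hB
    set Ak := Rk \ E with hAk
    have hAk2 : μ.real Rk ≤ 2 * μ.real Ak := by
      have : μ.real Ak = μ.real Rk - μ.real E := by
        have h5 := measureReal_inter_add_diff (μ := μ) (s := Rk) hEm hRf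
        have h6 : Rk ∩ E = E := inter_eq_right.2 inter_subset_left
        rw [h6] at h5
        linarith
      linarith
    have hRp : 0 < μ.real Rk := h.pos hkS (by linarith)
    have hAp : 0 < μ.real Ak := by linarith
    have hMk : M k / μ.real Ak ≤ 2 * B := by
      rw [div_le_iff₀ hAp]
      have h1 : M k ≤ ∫ y in cube k (3 * ρ k), |a y| ∂μ :=
        setIntegral_mono_set hai.abs.integrableOn (Filter.Eventually.of_forall fun _ => abs_nonneg _)
          (LE.le.eventuallyLE (cube_mono k (by linarith)))
      nlinarith
    have hupd : ∀ x ∈ s, Function.update A k Ak x = A x := fun x hx =>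
      Function.update_of_ne (fun he : x = k => hk (by rw [← he]; exact hx)) _ _
    refine ⟨Function.update A k Ak, ?_, fun y => ?_⟩
    · intro x hx
      rcases Finset.mem_insert.1 hx with rfl | hx
      · rw [Function.update_self]
        exact ⟨hRm.diff hEm, sdiff_subset, hAk2⟩
      · rw [hupd x hx]; exact hA x hx
    · rw [Finset.sum_insert hk, Function.update_self]
      have e : ∑ x ∈ s, M x / μ.real (Function.update A k Ak x) * indicator (Function.update A k Ak x) (fun _ => (1 : ℝ)) y = Ψ y :=
        Finset.sum_congr rfl fun x hx => by rw [hupd x hx]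
      rw [e]
      by_cases hy : y ∈ Ak
      · rw [indicator_of_mem hy, mul_one]
        have : Ψ y < 2 * B := by
          by_contra! hc
          exact hy.2 ⟨hy.1, hc⟩
        linarith
      · rw [indicator_of_notMem hy, mul_zero, zero_add]
        exact hAs y

end TolsaAux

open MeasureTheory Metric Set Function
open scoped Classical
open scoped ENNReal NNReal BigOperators

namespace TolsaAux

variable {d : ℕ}
variable {μ : Measure (Euc d)} {n : ℕ} {C p : ℝ}

/-- simple `p`-block -/
structure Simple (n : ℕ) (p : ℝ) (a : Euc d → ℝ) (Q D : CubeOf μ) (s : ℝ) : Prop where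
  meas : Measurable a
  supp : ∀ x ∉ Q.set, a x = 0
  int : Integrable (fun x => |a x| ^ p) μ
  dbl : Dbl μ D.c D.ℓ
  sub : cube Q.c (2 * Q.ℓ) ⊆ D.set
  pos : 0 < s
  bound : ∫ x, |a x| ^ p ∂μ ≤
    (s / (μ.real (cube Q.c (4 * Q.ℓ)) * Kcoef n Q D)) ^ p * μ.real (cube Q.c (4 * Q.ℓ))

theorem Simple.integrable (h : Grow μ n C) (hp : 1 < p) {a : Euc d → ℝ} {Q D : CubeOf μ} {s : ℝ}
    (S : Simple n p a Q D s) : Integrable a μ := by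
  have h1 : IntegrableOn a Q.set μ := absInt hp S.meas S.int.integrableOn (h.fin _ _)
  have hQm : MeasurableSet Q.set := measurableSet_cube _ _
  rw [← integrable_indicator_iff hQm] at h1
  refine h1.congr (Filter.Eventually.of_forall fun y => ?_)
  by_cases hy : y ∈ Q.set
  · rw [indicator_of_mem hy]
  · rw [indicator_of_notMem hy, S.supp y hy]

theorem Simple.L1 (h : Grow μ n C) (hp : 1 < p) {a : Euc d → ℝ} {Q D : CubeOf μ} {s : ℝ}
    (S : Simple n p a Q D s) : ∫ x, |a x| ∂μ ≤ 2 * s := by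
  have hQ := Q.ℓ_pos
  have hs := S.pos
  set V := μ.real (cube Q.c (4 * Q.ℓ)) with hV
  have hVp : 0 < V := h.pos Q.c_mem (by linarith)
  have hK := one_le_K (n := n) Q D
  have e : ∫ x, |a x| ∂μ = ∫ x in Q.set, |a x| ∂μ := by
    rw [setIntegral_eq_integral_of_forall_compl_eq_zero]
    intro x hx; rw [S.supp x hx, abs_zero]
  have hu : 0 < s / (V * Kcoef n Q D) := by positivity
  have h1 := absInt_le hp S.meas (E := Q.set) S.int.integrableOn (h.fin _ _) hu
  have h2 : ∫ x in Q.set, |a x| ^ p ∂μ ≤ (s / (V * Kcoef n Q D)) ^ p * V :=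
    (setIntegral_le_integral S.int (Filter.Eventually.of_forall fun x => by positivity)).trans S.bound
  have h3 : μ.real Q.set ≤ V := h.mono_real (cube_mono _ (by linarith))
  rw [e]
  calc _ ≤ _ := h1
    _ ≤ (s / (V * Kcoef n Q D)) * (V + V) := by
        gcongr
        rw [div_le_iff₀ (by positivity)]
        linarith
    _ = 2 * s / Kcoef n Q D := by field_simp; ring
    _ ≤ 2 * s := div_le_self (by positivity) hK

theorem Grow.L1_Lop (h : Grow μ n C) {D : CubeOf μ} {a : Euc d → ℝ} (ha : Integrable a μ) :
    ∫ x, |Lop D a x| ∂μ ≤ 2 * ∫ x, |a x| ∂μ := by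
  have hD := h.posD D
  have h2 : Integrable (indicator D.set (fun _ => (1 : ℝ))) μ := h.integrable_ind D.c D.ℓ
  set c := (∫ y, a y ∂μ) / μ.real D.set with hc
  have hcb : |c| * μ.real D.set ≤ ∫ x, |a x| ∂μ := by
    rw [hc, abs_div, abs_of_pos hD, div_mul_cancel₀ _ hD.ne']
    exact abs_integral_le_integral_abs
  have h3 : ∫ x, |Lop D a x| ∂μ ≤ ∫ x, (|a x| + |c| * indicator D.set (fun _ => (1 : ℝ)) x) ∂μ := by
    refine integral_mono (h.integrable_Lop ha).abs (ha.abs.add (h2.const_mul _)) fun x => ?_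
    simp only [Lop, ← hc]
    refine (abs_sub _ _).trans ?_
    rw [abs_mul, abs_of_nonneg (indicator_nonneg (fun _ _ => zero_le_one) x)]
  refine h3.trans ?_
  rw [integral_add ha.abs (h2.const_mul _), integral_const_mul, h.int_ind]
  linarith

/-- finite sums of simple blocks -/
inductive PS (μ : Measure (Euc d)) (n : ℕ) (p : ℝ) : ℝ → (Euc d → ℝ) → Prop
  | zero : PS μ n p 0 (fun _ => 0)
  | simple {a : Euc d → ℝ} {Q D : CubeOf μ} {s : ℝ} (S : Simple n p a Q D s) : PS μ n p s (Lop D a)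
  | add {s t : ℝ} {f g : Euc d → ℝ} (hf : PS μ n p s f) (hg : PS μ n p t g) :
      PS μ n p (s + t) (fun x => f x + g x)
  | congr {s t : ℝ} {f g : Euc d → ℝ} (hf : PS μ n p s f) (hst : s ≤ t) (hfg : f =ᵐ[μ] g) : PS μ n p t g

theorem PS.sum {ι : Type*} (t : Finset ι) {s : ι → ℝ} {F : ι → Euc d → ℝ} (hF : ∀ i ∈ t, PS μ n p (s i) (F i)) :
    PS μ n p (∑ i ∈ t, s i) (fun x => ∑ i ∈ t, F i x) := by
  induction t using Finset.induction_on with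
  | empty => simpa using PS.zero
  | insert k t hk ih =>
    simp only [Finset.sum_insert hk]
    exact PS.add (hF k (Finset.mem_insert_self _ _)) (ih fun i hi => hF i (Finset.mem_insert_of_mem hi))

theorem PS.L1 (h : Grow μ n C) (hp : 1 < p) {s : ℝ} {f : Euc d → ℝ} (hf : PS μ n p s f) :
    0 ≤ s ∧ Integrable f μ ∧ ∫ x, |f x| ∂μ ≤ 4 * s := by
  induction hf with
  | zero => simp
  | simple S =>
    refine ⟨S.pos.le, h.integrable_Lop (S.integrable h hp), ?_⟩
    have h1 := h.L1_Lop (D := by assumption) (S.integrable h hp)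
    refine h1.trans ?_
    have := S.L1 h hp
    linarith
  | @add s t f g hf hg ihf ihg =>
    obtain ⟨a1, a2, a3⟩ := ihf
    obtain ⟨b1, b2, b3⟩ := ihg
    refine ⟨by positivity, a2.add b2, ?_⟩
    have : ∫ x, |f x + g x| ∂μ ≤ ∫ x, (|f x| + |g x|) ∂μ :=
      integral_mono (a2.add b2).abs (a2.abs.add b2.abs) fun x => abs_add_le _ _
    rw [integral_add a2.abs b2.abs] at this
    linarith
  | @congr s t f g hf hst hfg ih =>
    obtain ⟨a1, a2, a3⟩ := ih
    refine ⟨a1.trans hst, a2.congr hfg, ?_⟩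
    have : ∫ x, |f x| ∂μ = ∫ x, |g x| ∂μ := integral_congr_ae (hfg.fun_comp (fun y => |y|))
    linarith

theorem Lop_add {D : CubeOf μ} {f g : Euc d → ℝ} (hf : Integrable f μ) (hg : Integrable g μ) (x : Euc d) :
    Lop D (fun y => f y + g y) x = Lop D f x + Lop D g x := by
  simp only [Lop]
  rw [integral_add hf hg]; ring

theorem Lop_sum {D : CubeOf μ} {ι : Type*} (t : Finset ι) {F : ι → Euc d → ℝ} (hF : ∀ i ∈ t, Integrable (F i) μ) (x : Euc d) :
    Lop D (fun y => ∑ i ∈ t, F i y) x = ∑ i ∈ t, Lop D (F i) x := by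
  simp only [Lop]
  rw [integral_finset_sum t hF, Finset.sum_sub_distrib, Finset.sum_div, Finset.sum_mul]

theorem indicator_rpow (hp : 1 < p) (E : Set (Euc d)) (a : Euc d → ℝ) :
    (fun x => |indicator E a x| ^ p) = indicator E (fun x => |a x| ^ p) := by
  ext x
  by_cases hx : x ∈ E
  · rw [indicator_of_mem hx, indicator_of_mem hx]
  · rw [indicator_of_notMem hx, indicator_of_notMem hx, abs_zero, Real.zero_rpow (by linarith)]

/-- the restriction to a stopping cube is a simple block -/
theorem Grow.simple_halt (h : Grow μ n C) (hp : 1 < p) {a : Euc d → ℝ} (ha : Measurable a)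
    (hai : Integrable (fun x => |a x| ^ p) μ) {P D : CubeOf μ} {lam K β : ℝ} (hl : 0 < lam) (hβ : 1 ≤ β)
    (hP : lam ^ p * μ.real (cube P.c (4 * P.ℓ)) ≤ β * ∫ x in P.set, |a x| ^ p ∂μ)
    (hD : Dbl μ D.c D.ℓ) (hsub : cube P.c (2 * P.ℓ) ⊆ D.set) (hK : Kcoef n P D ≤ K) :
    Simple n p (indicator P.set a) P D (β * lam * ((∫ x in P.set, |a x| ^ p ∂μ) / lam ^ p) * K) := by
  have hPm : MeasurableSet P.set := measurableSet_cube _ _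
  have hPl := P.ℓ_pos
  set V := μ.real (cube P.c (4 * P.ℓ)) with hV
  have hVp : 0 < V := h.pos P.c_mem (by linarith)
  set I := ∫ x in P.set, |a x| ^ p ∂μ with hI
  have hΛ : 0 < lam ^ p := by positivity
  have hIp : 0 < I := by
    by_contra! hc
    have : 0 < lam ^ p * V := by positivity
    nlinarith
  have hK1 := one_le_K (n := n) P D
  have hKp : 0 < K := by linarith
  refine ⟨ha.indicator hPm, fun x hx => indicator_of_notMem hx _, ?_, hD, hsub, by positivity, ?_⟩
  · rw [indicator_rpow hp]; exact hai.indicator hPm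
  · rw [indicator_rpow hp, integral_indicator hPm, ← hI, ← hV]
    have hy : 1 ≤ β * (I / lam ^ p) / V := by
      rw [le_div_iff₀ hVp, one_mul, mul_div_assoc', le_div_iff₀ hΛ]
      linarith
    have h1 : lam * (β * (I / lam ^ p) / V) ≤ β * lam * (I / lam ^ p) * K / (V * Kcoef n P D) := by
      rw [le_div_iff₀ (by positivity)]
      calc lam * (β * (I / lam ^ p) / V) * (V * Kcoef n P D) = β * lam * (I / lam ^ p) * Kcoef n P D := by
            field_simp
        _ ≤ _ := by gcongr
    have h2 : (lam * (β * (I / lam ^ p) / V)) ^ p ≤ (β * lam * (I / lam ^ p) * K / (V * Kcoef n P D)) ^ p := by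
      gcongr
    refine le_trans ?_ (mul_le_mul_of_nonneg_right h2 hVp.le)
    rw [Real.mul_rpow hl.le (by positivity)]
    have h3 : β * (I / lam ^ p) / V ≤ (β * (I / lam ^ p) / V) ^ p := Real.self_le_rpow_of_one_le hy hp.le
    calc I ≤ β * I := by nlinarith
      _ = lam ^ p * (β * (I / lam ^ p) / V) * V := by field_simp
      _ ≤ _ := by gcongr

end TolsaAux

open MeasureTheory Metric Set Function
open scoped Classical
open scoped ENNReal NNReal BigOperators

namespace TolsaAux

variable {d : ℕ}
variable {μ : Measure (Euc d)} {n : ℕ} {C p : ℝ}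

/-- the covering property -/
def CovProp (d N : ℕ) : Prop := ∀ (ν : Measure (Euc d)) [IsFiniteMeasure ν] (s : Set (Euc d))
    (r : Euc d → ℝ) (L : ℝ), (∀ x ∈ s, 0 < r x) → (∀ x ∈ s, r x ≤ L) →
    ∃ t : Finset (Euc d), ↑t ⊆ s ∧ ν (s \ ⋃ x ∈ t, cube x (r x)) ≤ N / (N + 1) * ν s ∧
      (t : Set (Euc d)).PairwiseDisjoint fun x => cube x (r x)

theorem Grow.family (h : Grow μ n C) (hp : 1 < p) {N : ℕ} (hN : CovProp d N) {a : Euc d → ℝ}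
    (ha : Measurable a) {Q : CubeOf μ} (hsupp : ∀ x ∉ Q.set, a x = 0)
    (hint : Integrable (fun x => |a x| ^ p) μ) {lam : ℝ} (hl : 0 < lam)
    (htot : 32 ^ (d + 1) * ∫ x, |a x| ^ p ∂μ ≤ lam ^ p * μ.real (cube Q.c (4 * Q.ℓ))) :
    ∃ (t : Finset (Euc d)) (P R : Euc d → CubeOf μ), (∀ x ∈ t, x ∈ Q.set ∧
      (P x).c = x ∧ (R x).c = x ∧ 2 * (P x).ℓ < Q.ℓ ∧ 2 * (P x).ℓ ≤ (R x).ℓ ∧ Dbl μ x (R x).ℓ ∧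
      (∀ r, (P x).ℓ < r → μ.real (cube x r) / r ^ n ≤ C * 32 ^ (n + 1) * (r / (R x).ℓ)) ∧
      lam ^ p * μ.real (cube x (4 * (P x).ℓ)) ≤ 32 ^ (d + 1) * ∫ y in cube x (P x).ℓ, |a y| ^ p ∂μ ∧
      ∫ y in cube x (3 * (R x).ℓ), |a y| ^ p ∂μ ≤ lam ^ p * μ.real (cube x (R x).ℓ)) ∧
      (t : Set (Euc d)).PairwiseDisjoint (fun x => cube x (P x).ℓ) ∧
      ∫ y in {y | lam < |a y|} \ ⋃ x ∈ t, cube x (P x).ℓ, |a y| ^ p ∂μ ≤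
        N / (N + 1) * ∫ x, |a x| ^ p ∂μ := by
  have hΛ : 0 < lam ^ p := by positivity
  have hgm : Measurable (fun x => ENNReal.ofReal (|a x| ^ p)) := by
    have : Measurable (fun x => |a x| ^ p) := (by fun_prop)
    exact this.ennreal_ofReal
  set ν : Measure (Euc d) := μ.withDensity (fun x => ENNReal.ofReal (|a x| ^ p)) with hν
  haveI : IsFiniteMeasure ν := isFiniteMeasure_withDensity_ofReal hint.2
  have hνE : ∀ E : Set (Euc d), MeasurableSet E → ν.real E = ∫ y in E, |a y| ^ p ∂μ := by
    intro E hE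
    rw [Measure.real, hν, withDensity_apply _ hE,
      integral_eq_lintegral_of_nonneg_ae (Filter.Eventually.of_forall fun x => by positivity)
        hint.integrableOn.aestronglyMeasurable]
  have hνu : ν.real univ = ∫ y, |a y| ^ p ∂μ := by rw [hνE univ MeasurableSet.univ]; simp
  have hfin : ∫⁻ x, ENNReal.ofReal (|a x| ^ p) ∂μ ≠ ∞ := by
    have := measure_ne_top ν univ
    rwa [hν, withDensity_apply _ MeasurableSet.univ, Measure.restrict_univ] at this
  have hleb := h.ae_lebesgue hgm hfin
  let G : Set (Euc d) := {x | (x ∈ measSupp μ ∧ ∀ ε : ℝ, 0 < ε → ∃ t, 0 < t ∧ t < ε ∧ Dbl μ x t) ∧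
    Filter.Tendsto (fun t => (∫⁻ y in cube x t, ENNReal.ofReal (|a y| ^ p) ∂μ) / μ (cube x t))
      (nhdsWithin 0 (Ioi 0)) (nhds (ENNReal.ofReal (|a x| ^ p)))}
  have hG : ∀ᵐ x ∂μ, x ∈ G := by
    filter_upwards [h.ae_small, hleb] with x h1 h2 using ⟨h1, h2⟩
  let s0 : Set (Euc d) := {x | lam < |a x|} ∩ G
  have key : ∀ x, ∃ P R : CubeOf μ, x ∈ s0 → x ∈ Q.set ∧
      P.c = x ∧ R.c = x ∧ 2 * P.ℓ < Q.ℓ ∧ 2 * P.ℓ ≤ R.ℓ ∧ Dbl μ x R.ℓ ∧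
      (∀ r, P.ℓ < r → μ.real (cube x r) / r ^ n ≤ C * 32 ^ (n + 1) * (r / R.ℓ)) ∧
      lam ^ p * μ.real (cube x (4 * P.ℓ)) ≤ 32 ^ (d + 1) * ν.real (cube x P.ℓ) ∧
      ν.real (cube x (3 * R.ℓ)) ≤ lam ^ p * μ.real (cube x R.ℓ) := by
    intro x
    by_cases hx : x ∈ s0
    · obtain ⟨hx1, ⟨hx2, hx3⟩, hx4⟩ := hx
      have hx1 : lam < |a x| := hx1
      have hxQ : x ∈ Q.set := by
        by_contra hc
        rw [hsupp x hc, abs_zero] at hx1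
        linarith
      obtain ⟨P, R, hPR⟩ := h.haltCube (ν := ν) hΛ hx2 hxQ hx3 (by
        have hlt : ENNReal.ofReal (lam ^ p) < ENNReal.ofReal (|a x| ^ p) := by
          refine (ENNReal.ofReal_lt_ofReal_iff (Real.rpow_pos_of_pos (hl.trans hx1) p)).2 ?_
          exact Real.rpow_lt_rpow hl.le hx1 (by linarith)
        have h5 := hx4.eventually (lt_mem_nhds hlt)
        rw [eventually_nhdsWithin_iff, Metric.eventually_nhds_iff] at h5
        obtain ⟨ε, hε, h5⟩ := h5
        refine ⟨ε, hε, fun t ht hte => ?_⟩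
        have h6 := h5 (y := t) (by rw [Real.dist_eq, sub_zero, abs_of_pos ht]; exact hte) ht
        have hpos := h.pos hx2 ht
        have hpos' : μ (cube x t) ≠ 0 := by
          intro h0; rw [Measure.real, h0] at hpos; simp at hpos
        rw [ENNReal.lt_div_iff_mul_lt (Or.inl hpos') (Or.inl (h.fin x t)),
          ← withDensity_apply _ (measurableSet_cube _ _), ← hν] at h6
        have h7 := (ENNReal.toReal_lt_toReal (ENNReal.mul_ne_top ENNReal.ofReal_ne_top (h.fin x t)) (measure_ne_top _ _)).2 h6
        rwa [ENNReal.toReal_mul, ENNReal.toReal_ofReal hΛ.le] at h7) (by rw [hνu]; exact htot)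
      exact ⟨P, R, fun _ => ⟨hxQ, hPR⟩⟩
    · exact ⟨Q, Q, fun hc => absurd hc hx⟩
  choose P R hPR using key
  obtain ⟨t, hts, htν, htd⟩ := hN ν s0 (fun x => (P x).ℓ) Q.ℓ (fun x _ => (P x).ℓ_pos)
    (fun x hx => by have := (hPR x hx).2.2.2.1; have := (P x).ℓ_pos; linarith)
  refine ⟨t, P, R, ?_, htd, ?_⟩
  · intro x hx
    have h1 := hPR x (hts hx)
    rw [hνE _ (measurableSet_cube _ _), hνE _ (measurableSet_cube _ _)] at h1
    exact h1
  · have hm1 : MeasurableSet {y | lam < |a y|} := measurableSet_lt measurable_const (by fun_prop)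
    have hm2 : MeasurableSet (⋃ x ∈ t, cube x (P x).ℓ) := t.measurableSet_biUnion fun x _ => measurableSet_cube _ _
    rw [← hνE _ (hm1.diff hm2), ← hνu]
    have hGν : ∀ᵐ x ∂ν, x ∈ G := (withDensity_absolutelyContinuous μ _).ae_le hG
    have h1 : ν ({y | lam < |a y|} \ ⋃ x ∈ t, cube x (P x).ℓ) ≤ N / (N + 1) * ν univ := by
      calc _ ≤ ν (s0 \ ⋃ x ∈ t, cube x (P x).ℓ) := by
            refine measure_mono_ae ?_
            filter_upwards [hGν] with x hx hx2
            exact ⟨⟨hx2.1, hx⟩, hx2.2⟩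
        _ ≤ _ := htν
        _ ≤ _ := by gcongr; exact subset_univ _
    have h2 : (N / (N + 1) * ν univ : ℝ≥0∞) ≠ ∞ := by
      refine ENNReal.mul_ne_top (ENNReal.div_ne_top (by simp) (by simp)) (measure_ne_top _ _)
    have h3 := ENNReal.toReal_mono h2 h1
    rw [ENNReal.toReal_mul, ENNReal.toReal_div, ENNReal.toReal_add (by simp) (by simp)] at h3
    simpa [Measure.real] using h3

end TolsaAux

open MeasureTheory Metric Set Function
open scoped Classical
open scoped ENNReal NNReal BigOperators

namespace TolsaAux

variable {d : ℕ}
variable {μ : Measure (Euc d)} {n : ℕ} {C p : ℝ}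

theorem Grow.int_phi (h : Grow μ n C) {x : Euc d} {t m : ℝ} {A : Set (Euc d)} (hA : MeasurableSet A)
    (hAs : A ⊆ cube x t) (hpos : 0 < μ.real A) :
    Integrable (fun y => m / μ.real A * indicator A (fun _ => (1 : ℝ)) y) μ ∧
    ∫ y, m / μ.real A * indicator A (fun _ => (1 : ℝ)) y ∂μ = m := by
  have hAf : μ A ≠ ∞ := ne_top_of_le_ne_top (h.fin x t) (measure_mono hAs)
  have h1 : Integrable (indicator A (fun _ => (1 : ℝ))) μ := by
    rw [integrable_indicator_iff hA]; exact integrableOn_const hAf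
  refine ⟨h1.const_mul _, ?_⟩
  rw [integral_const_mul, integral_indicator hA]
  simp
  field_simp

theorem Grow.hatb_phi (h : Grow μ n C) {R : CubeOf μ} (hR : Dbl μ R.c R.ℓ) {A : Set (Euc d)} (hA : MeasurableSet A)
    (hAs : A ⊆ R.set) (hAR : μ.real R.set ≤ 2 * μ.real A) {m M : ℝ} (hm : |m| ≤ M) :
    hatbNorm μ n (Lop R (fun y => -(m / μ.real A * indicator A (fun _ => (1 : ℝ)) y))) ≤
      ENNReal.ofReal (Cinf d C * (2 * M * 32 ^ (d + 1) * (1 + 2 * C))) := by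
  have hRp := h.posD R
  have hC := h.hC
  have hAp : 0 < μ.real A := by linarith
  have hM0 : 0 ≤ M := (abs_nonneg _).trans hm
  have hlR := R.ℓ_pos
  refine (h.hatb_Lop (Q := R) (D := R) (M := 2 * M / μ.real R.set) subset_rfl hR ?_ ?_ ?_).trans ?_
  · exact ((measurable_const.indicator hA).const_mul _).neg
  · intro y hy
    rw [indicator_of_notMem (fun hc => hy (hAs hc))]; simp
  · intro y
    rw [abs_neg, abs_mul, abs_div, abs_of_pos hAp, abs_of_nonneg (indicator_nonneg (fun _ _ => zero_le_one) y)]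
    have h1 : indicator A (fun _ => (1 : ℝ)) y ≤ 1 := indicator_le_self' (fun _ _ => zero_le_one) y
    calc _ ≤ |m| / μ.real A * 1 := by gcongr
      _ ≤ 2 * M / μ.real R.set := by
        rw [mul_one, div_le_div_iff₀ hAp hRp]
        nlinarith
  · apply ENNReal.ofReal_le_ofReal
    have hCi : 0 ≤ Cinf d C := by unfold Cinf; positivity
    have h1 : μ.real (cube R.c (2 * R.ℓ)) ≤ 32 ^ (d + 1) * μ.real R.set :=
      (h.mono_real (cube_mono _ (by linarith))).trans hR
    have h2 : Kcoef n R R ≤ 1 + 2 * C := h.K_comparable (by linarith)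
    have h3 := one_le_K (n := n) R R
    have h4 : 2 * M / μ.real R.set * μ.real (cube R.c (2 * R.ℓ)) ≤ 2 * M * 32 ^ (d + 1) := by
      calc _ ≤ 2 * M / μ.real R.set * (32 ^ (d + 1) * μ.real R.set) := by gcongr
        _ = _ := by field_simp
    refine mul_le_mul_of_nonneg_left ?_ hCi
    exact mul_le_mul h4 h2 (by linarith) (by positivity)

theorem Lop_split (R D : CubeOf μ) {F φ : Euc d → ℝ} (hF : Integrable F μ) (hφ : Integrable φ μ)
    (he : ∫ y, φ y ∂μ = ∫ y, F y ∂μ) (x : Euc d) :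
    Lop D F x = Lop R F x + Lop R (fun y => -φ y) x + Lop D φ x := by
  simp only [Lop]
  rw [integral_neg, he]; ring

def K1 (n : ℕ) (C : ℝ) : ℝ := 1 + 4 * (C * 32 ^ (n + 1))
def K2 (n : ℕ) (C : ℝ) : ℝ := K1 n C + 8 ^ n * (3 * C + 1)
def K3 (n : ℕ) (C : ℝ) : ℝ := (1 + 2 * C) + 8 ^ n * (3 * C + 1)
noncomputable def Cst (d n : ℕ) (C A : ℝ) : ℝ :=
  Cinf d C * A + 4 * Cinf d C * 32 ^ (d + 1) * (1 + 2 * C) + Cinf d C * (4 * (32 ^ (d + 1) + 1)) * K3 n C * A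

set_option maxHeartbeats 1000000 in
theorem Grow.step_simple (h : Grow μ n C) (hp : 1 < p) {N : ℕ} (hN : CovProp d N) {A θ : ℝ}
    (hA : 32 ^ (d + 1) ≤ A) (hθ : 0 < θ) (hθN : (N : ℝ) / (N + 1) ≤ θ ^ p)
    {a : Euc d → ℝ} {Q D : CubeOf μ} {s : ℝ} (S : Simple n p a Q D s) :
    ∃ g hh : Euc d → ℝ, (∀ x, Lop D a x = g x + hh x) ∧ hatbNorm μ n g ≤ ENNReal.ofReal (Cst d n C A * s) ∧
      PS μ n p (θ * s + 32 ^ (d + 1) * (K1 n C + K2 n C) * (A * (A ^ p)⁻¹) * s) hh := by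
  have hQl := Q.ℓ_pos
  have hs := S.pos
  have hC := h.hC
  have hai := S.integrable h hp
  have hm := S.meas
  have hL1 := S.L1 h hp
  set β : ℝ := 32 ^ (d + 1) with hβ
  have hβ1 : 1 ≤ β := one_le_pow₀ (by norm_num)
  have hA1 : 1 ≤ A := hβ1.trans hA
  set V := μ.real (cube Q.c (4 * Q.ℓ)) with hV
  have hVp : 0 < V := h.pos Q.c_mem (by linarith)
  set K := Kcoef n Q D with hK
  have hK1 : 1 ≤ K := one_le_K Q D
  have hKp : 0 < K := by linarith
  set u := s / (V * K) with hu
  have hup : 0 < u := by positivity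
  obtain ⟨lam, hlam⟩ : ∃ lam, lam = A * u := ⟨_, rfl⟩
  have hlp : 0 < lam := by rw [hlam]; positivity
  have hlVK : lam * V * K = A * s := by rw [hlam, hu]; field_simp
  have hΛ : lam ^ p = A ^ p * u ^ p := by rw [hlam, Real.mul_rpow (by positivity) hup.le]
  have hΛp : 0 < lam ^ p := by positivity
  have hup' : 0 < u ^ p := by positivity
  have hAp' : A ≤ A ^ p := Real.self_le_rpow_of_one_le hA1 hp.le
  have hb : ∫ x, |a x| ^ p ∂μ ≤ u ^ p * V := S.bound
  have htot : β * ∫ x, |a x| ^ p ∂μ ≤ lam ^ p * V := by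
    rw [hΛ]
    calc _ ≤ A ^ p * (u ^ p * V) := by
          have : 0 ≤ ∫ x, |a x| ^ p ∂μ := integral_nonneg fun x => by positivity
          exact mul_le_mul (hA.trans hAp') hb this (by positivity)
      _ = _ := by ring
  obtain ⟨t, P, R, hPR, hdis, hrem⟩ := h.family hp hN hm S.supp S.int hlp htot
  have hPset : ∀ x ∈ t, (P x).set = cube x (P x).ℓ := by
    intro x hx
    change cube (P x).c _ = _
    rw [(hPR x hx).2.1]
  have hRset : ∀ x ∈ t, (R x).set = cube x (R x).ℓ := by
    intro x hx
    change cube (R x).c _ = _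
    rw [(hPR x hx).2.2.1]
  have hsupp : ∀ x ∈ t, x ∈ measSupp μ := fun x hx => (hPR x hx).2.1 ▸ (P x).c_mem
  set F : Euc d → Euc d → ℝ := fun x => indicator (P x).set a with hF
  have hPm : ∀ x, MeasurableSet (P x).set := fun x => measurableSet_cube _ _
  have hFi : ∀ x, Integrable (F x) μ := fun x => hai.indicator (hPm x)
  -- masses
  set w : Euc d → ℝ := fun x => (∫ y in (P x).set, |a y| ^ p ∂μ) / lam ^ p with hw
  have hdis' : (t : Set (Euc d)).PairwiseDisjoint (fun x => (P x).set) := by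
    intro x hx y hy hxy
    have := hdis hx hy hxy
    simp only [Function.onFun] at this ⊢
    rwa [hPset x hx, hPset y hy]
  have hwn : ∀ x, 0 ≤ w x := fun x => by
    simp only [hw]
    have : 0 ≤ ∫ y in (P x).set, |a y| ^ p ∂μ := integral_nonneg fun x => by positivity
    positivity
  have hws : ∑ x ∈ t, w x ≤ V * (A ^ p)⁻¹ := by
    simp only [hw]
    rw [← Finset.sum_div, ← integral_biUnion_finset t (fun x _ => hPm x) hdis' (fun x _ => S.int.integrableOn),
      div_le_iff₀ hΛp]
    refine (setIntegral_le_integral S.int (Filter.Eventually.of_forall fun x => by positivity)).trans ?_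
    rw [hΛ]
    refine hb.trans (le_of_eq ?_)
    have : A ^ p ≠ 0 := by positivity
    field_simp
  have hMs : ∑ x ∈ t, ∫ y in (P x).set, |a y| ∂μ ≤ 2 * s := by
    rw [← integral_biUnion_finset t (fun x _ => hPm x) hdis' (fun x _ => hai.abs.integrableOn)]
    exact (setIntegral_le_integral hai.abs (Filter.Eventually.of_forall fun x => abs_nonneg _)).trans hL1
  set U : Set (Euc d) := ⋃ x ∈ t, cube x (P x).ℓ with hU
  have hU' : U = ⋃ x ∈ t, (P x).set := by
    rw [hU]; exact iUnion₂_congr fun x hx => (hPset x hx).symm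
  have hUm : MeasurableSet U := t.measurableSet_biUnion fun x _ => measurableSet_cube _ _
  have hlm : MeasurableSet {y | lam < |a y|} := measurableSet_lt measurable_const (by fun_prop)
  set E1 : Set (Euc d) := {y | lam < |a y|} \ U with hE1
  set E0 : Set (Euc d) := {y | lam < |a y|}ᶜ \ U with hE0
  have hE1m : MeasurableSet E1 := hlm.diff hUm
  have hE0m : MeasurableSet E0 := hlm.compl.diff hUm
  have hdec : a = fun y => (indicator E0 a y + indicator E1 a y) + ∑ x ∈ t, F x y := by
    have e := Finset.indicator_biUnion t (fun x => (P x).set) (f := a) hdis'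
    rw [← hU'] at e
    ext y
    rw [← congrFun e y]
    by_cases h1 : y ∈ U <;> by_cases h2 : lam < |a y| <;> simp [indicator, hE0, hE1, h1, h2]
  have hLdec : ∀ x, Lop D a x = (Lop D (indicator E0 a) x + Lop D (indicator E1 a) x) + ∑ z ∈ t, Lop D (F z) x := by
    intro x
    conv_lhs => rw [hdec]
    rw [Lop_add (f := fun y => indicator E0 a y + indicator E1 a y) ((hai.indicator hE0m).add (hai.indicator hE1m)) (integrable_finset_sum _ fun z _ => hFi z),
      Lop_add (hai.indicator hE0m) (hai.indicator hE1m), Lop_sum t (fun z _ => hFi z)]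
  -- the remainder
  have hSrem : Simple n p (indicator E1 a) Q D (θ * s) := by
    refine ⟨hm.indicator hE1m, ?_, ?_, S.dbl, S.sub, by positivity, ?_⟩
    · intro x hx
      by_cases hx1 : x ∈ E1
      · rw [indicator_of_mem hx1, S.supp x hx]
      · rw [indicator_of_notMem hx1]
    · rw [indicator_rpow hp]; exact S.int.indicator hE1m
    · rw [indicator_rpow hp, integral_indicator hE1m, ← hV, ← hK, mul_div_assoc, ← hu,
        Real.mul_rpow hθ.le hup.le]
      refine hrem.trans ?_
      calc _ ≤ θ ^ p * (u ^ p * V) := by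
            have : 0 ≤ ∫ x, |a x| ^ p ∂μ := integral_nonneg fun x => by positivity
            gcongr
        _ = _ := by ring
  -- the stopping cubes
  set tL := t.filter (fun x => Q.ℓ < (R x).ℓ) with htL
  set tS := t.filter (fun x => ¬ Q.ℓ < (R x).ℓ) with htS
  have hk1p : 1 ≤ K1 n C := by unfold K1; have : 0 ≤ C * 32 ^ (n + 1) := by positivity
                               linarith
  have hQD : Q.set ⊆ D.set := (cube_mono _ (by linarith)).trans S.sub
  have hPint : ∀ x ∈ t, ∫ y in (P x).set, |a y| ^ p ∂μ = ∫ y in cube x (P x).ℓ, |a y| ^ p ∂μ := by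
    intro x hx; rw [hPset x hx]
  have hSL : ∀ x ∈ tL, Simple n p (F x) (P x) D (β * lam * w x * (K2 n C * K)) := by
    intro x hx
    obtain ⟨hxt, hxR⟩ := Finset.mem_filter.1 hx
    obtain ⟨q1, q2, q3, q4, q5, q6, q7, q8, q9⟩ := hPR x hxt
    have hPl := (P x).ℓ_pos
    refine h.simple_halt hp hm S.int hlp hβ1 ?_ S.dbl ?_ ?_
    · rw [hPint x hxt, q2]; exact q8
    · rw [q2]; exact (cube_subset q1 (by linarith)).trans S.sub
    · have t1 := h.K_triangle (Q' := P x) (Q := Q) (D := D) (by rw [q2]; exact q1) (by linarith)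
      have t2 : Kcoef n (P x) Q ≤ K1 n C := h.K_geom (T := (R x).ℓ) (by positivity) (by linarith) hxR.le
        (by rw [q2]; exact q7)
      rw [← hK] at t1
      unfold K2
      nlinarith
  have hSS : ∀ x ∈ tS, Simple n p (F x) (P x) (R x) (β * lam * w x * K1 n C) := by
    intro x hx
    obtain ⟨hxt, hxR⟩ := Finset.mem_filter.1 hx
    obtain ⟨q1, q2, q3, q4, q5, q6, q7, q8, q9⟩ := hPR x hxt
    have hPl := (P x).ℓ_pos
    refine h.simple_halt hp hm S.int hlp hβ1 ?_ (by rw [q3]; exact q6) ?_ ?_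
    · rw [hPint x hxt, q2]; exact q8
    · rw [q2, hRset x hxt]; exact cube_mono _ q5
    · exact h.K_geom (T := (R x).ℓ) (by positivity) (by linarith) le_rfl (by rw [q2]; exact q7)
  -- spreading
  obtain ⟨Ax, hAx, hAs⟩ := h.spread hai (r := fun x => (P x).ℓ) (ρ := fun x => (R x).ℓ) (B := lam * (β + 1)) (by positivity) tS
    (by
      intro x hx
      obtain ⟨hxt, hxR⟩ := Finset.mem_filter.1 hx
      obtain ⟨q1, q2, q3, q4, q5, q6, q7, q8, q9⟩ := hPR x hxt
      have hPl := (P x).ℓ_pos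
      have hRl := (R x).ℓ_pos
      refine ⟨hsupp x hxt, hPl, by linarith, ?_⟩
      refine (absInt_le hp hm (S.int.integrableOn) (h.fin _ _) hlp).trans ?_
      have e1 : μ.real (cube x (3 * (R x).ℓ)) ≤ β * μ.real (cube x (R x).ℓ) :=
        (h.mono_real (cube_mono _ (by linarith))).trans q6
      have e2 : (∫ y in cube x (3 * (R x).ℓ), |a y| ^ p ∂μ) / lam ^ p ≤ μ.real (cube x (R x).ℓ) := by
        rw [div_le_iff₀ hΛp]; linarith
      calc _ ≤ lam * (β * μ.real (cube x (R x).ℓ) + μ.real (cube x (R x).ℓ)) := by gcongr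
        _ = _ := by ring) (hdis.subset (by intro x hx; exact (Finset.mem_filter.1 hx).1))
  set φ : Euc d → Euc d → ℝ := fun x y => (∫ z, F x z ∂μ) / μ.real (Ax x) * indicator (Ax x) (fun _ => (1 : ℝ)) y with hφ
  have hmM : ∀ x, |∫ z, F x z ∂μ| ≤ ∫ z in (P x).set, |a z| ∂μ := by
    intro x
    simp only [hF]
    rw [integral_indicator (hPm x)]
    exact abs_integral_le_integral_abs
  have hAxp : ∀ x ∈ tS, 0 < μ.real (Ax x) := by
    intro x hx
    have := h.pos (hsupp x (Finset.mem_filter.1 hx).1) (R x).ℓ_pos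
    linarith [(hAx x hx).2.2]
  have hφi : ∀ x ∈ tS, Integrable (φ x) μ ∧ ∫ y, φ x y ∂μ = ∫ y, F x y ∂μ := by
    intro x hx
    exact h.int_phi (hAx x hx).1 (hAx x hx).2.1 (hAxp x hx)
  set Q2 : CubeOf μ := ⟨Q.c, 2 * Q.ℓ, by positivity, Q.c_mem⟩ with hQ2
  have hΦ : hatbNorm μ n (Lop D (fun y => ∑ x ∈ tS, φ x y)) ≤ ENNReal.ofReal (Cinf d C * (4 * (β + 1)) * K3 n C * A * s) := by
    refine (h.hatb_Lop (Q := Q2) (D := D) (M := 4 * (lam * (β + 1))) S.sub S.dbl ?_ ?_ ?_).trans ?_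
    · exact Finset.measurable_sum _ fun x hx => (measurable_const.indicator (hAx x hx).1).const_mul _
    · intro y hy
      refine Finset.sum_eq_zero fun x hx => ?_
      obtain ⟨hxt, hxR⟩ := Finset.mem_filter.1 hx
      have : y ∉ Ax x := fun hc => hy (cube_subset (hPR x hxt).1 (by
        show Q.ℓ + (R x).ℓ ≤ 2 * Q.ℓ
        linarith) ((hAx x hx).2.1 hc))
      simp only [hφ]
      rw [indicator_of_notMem this, mul_zero]
    · intro y
      refine le_trans ?_ (hAs y)
      refine (Finset.abs_sum_le_sum_abs _ _).trans (Finset.sum_le_sum fun x hx => ?_)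
      simp only [hφ]
      rw [abs_mul, abs_div, abs_of_pos (hAxp x hx), abs_of_nonneg (indicator_nonneg (fun _ _ => zero_le_one) y),
        ← hPset x (Finset.mem_filter.1 hx).1]
      have := hmM x
      have h3 := hAxp x hx
      have h4 : 0 ≤ indicator (Ax x) (fun _ => (1 : ℝ)) y := indicator_nonneg (fun _ _ => zero_le_one) y
      gcongr
    · apply ENNReal.ofReal_le_ofReal
      have e1 : μ.real (cube Q2.c (2 * Q2.ℓ)) = V := by
        rw [hV]
        show μ.real (cube Q.c (2 * (2 * Q.ℓ))) = _
        congr 2; ring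
      have t1 := h.K_triangle (Q' := Q2) (Q := Q) (D := D) (mem_cube_self _ hQl.le) (le_refl (2 * Q.ℓ))
      have t2 : Kcoef n Q2 Q ≤ 1 + 2 * C := h.K_comparable (by show Q.ℓ ≤ 4 * (2 * Q.ℓ); linarith)
      have t3 : Kcoef n Q2 D ≤ K3 n C * K := by
        unfold K3
        rw [← hK] at t1
        nlinarith
      rw [e1]
      have hCi : 0 ≤ Cinf d C := by unfold Cinf; positivity
      calc _ ≤ Cinf d C * (4 * (lam * (β + 1)) * V * (K3 n C * K)) := by gcongr
        _ = Cinf d C * (4 * (β + 1)) * K3 n C * (lam * V * K) := by ring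
        _ = _ := by rw [hlVK]; ring
  have hg0 : hatbNorm μ n (Lop D (indicator E0 a)) ≤ ENNReal.ofReal (Cinf d C * A * s) := by
    refine (h.hatb_Lop (Q := Q) (D := D) (M := lam) hQD S.dbl (hm.indicator hE0m) ?_ ?_).trans ?_
    · intro x hx
      by_cases hx1 : x ∈ E0
      · rw [indicator_of_mem hx1, S.supp x hx]
      · rw [indicator_of_notMem hx1]
    · intro y
      by_cases hx1 : y ∈ E0
      · rw [indicator_of_mem hx1]; exact not_lt.1 hx1.1
      · rw [indicator_of_notMem hx1, abs_zero]; exact hlp.le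
    · apply ENNReal.ofReal_le_ofReal
      have hCi : 0 ≤ Cinf d C := by unfold Cinf; positivity
      have e : μ.real (cube Q.c (2 * Q.ℓ)) ≤ V := h.mono_real (cube_mono _ (by linarith))
      calc _ ≤ Cinf d C * (lam * V * K) := by gcongr
        _ = _ := by rw [hlVK]; ring
  have hgφ : hatbNorm μ n (fun y => ∑ x ∈ tS, Lop (R x) (fun z => -φ x z) y) ≤
      ENNReal.ofReal (4 * Cinf d C * β * (1 + 2 * C) * s) := by
    have hCi : 0 ≤ Cinf d C := by unfold Cinf; positivity
    have hMn : ∀ x, 0 ≤ ∫ z in (P x).set, |a z| ∂μ := fun x => integral_nonneg fun z => abs_nonneg _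
    refine (hatb_sum h Q tS _).trans ?_
    calc _ ≤ ∑ x ∈ tS, ENNReal.ofReal (Cinf d C * (2 * (∫ z in (P x).set, |a z| ∂μ) * β * (1 + 2 * C))) := by
          refine Finset.sum_le_sum fun x hx => ?_
          obtain ⟨hxt, hxR⟩ := Finset.mem_filter.1 hx
          refine h.hatb_phi (R := R x) ?_ (hAx x hx).1 ?_ ?_ (hmM x)
          · rw [(hPR x hxt).2.2.1]; exact (hPR x hxt).2.2.2.2.2.1
          · rw [hRset x hxt]; exact (hAx x hx).2.1
          · rw [hRset x hxt]; exact (hAx x hx).2.2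
      _ = ENNReal.ofReal (∑ x ∈ tS, Cinf d C * (2 * (∫ z in (P x).set, |a z| ∂μ) * β * (1 + 2 * C))) := by
          rw [ENNReal.ofReal_sum_of_nonneg]
          intro x _
          have := hMn x
          positivity
      _ ≤ _ := by
          apply ENNReal.ofReal_le_ofReal
          have e : ∑ x ∈ tS, ∫ z in (P x).set, |a z| ∂μ ≤ 2 * s :=
            (Finset.sum_le_sum_of_subset_of_nonneg (Finset.filter_subset _ _) fun x _ _ => hMn x).trans hMs
          calc _ = Cinf d C * (2 * β * (1 + 2 * C)) * ∑ x ∈ tS, ∫ z in (P x).set, |a z| ∂μ := by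
                rw [Finset.mul_sum]
                exact Finset.sum_congr rfl fun x _ => by ring
            _ ≤ Cinf d C * (2 * β * (1 + 2 * C)) * (2 * s) := by gcongr
            _ = _ := by ring
  refine ⟨fun x => (Lop D (indicator E0 a) x + ∑ z ∈ tS, Lop (R z) (fun y => -φ z y) x) + Lop D (fun y => ∑ z ∈ tS, φ z y) x,
    fun x => (Lop D (indicator E1 a) x + ∑ z ∈ tL, Lop D (F z) x) + ∑ z ∈ tS, Lop (R z) (F z) x, ?_, ?_, ?_⟩
  · intro x
    rw [hLdec x, ← Finset.sum_filter_add_sum_filter_not t (fun x => Q.ℓ < (R x).ℓ), ← htL, ← htS]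
    have e0 := Lop_sum (D := D) tS (fun z hz => (hφi z hz).1) x
    have : ∑ z ∈ tS, Lop D (F z) x = ∑ z ∈ tS, Lop (R z) (F z) x + ∑ z ∈ tS, Lop (R z) (fun y => -φ z y) x
        + ∑ z ∈ tS, Lop D (φ z) x := by
      rw [← Finset.sum_add_distrib, ← Finset.sum_add_distrib]
      exact Finset.sum_congr rfl fun z hz => Lop_split (R z) D (hFi z) (hφi z hz).1 (hφi z hz).2 x
    rw [this, ← e0]
    ring
  · refine (hatb_add h _ _).trans ?_
    refine (add_le_add ((hatb_add h _ _).trans (add_le_add hg0 hgφ)) hΦ).trans ?_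
    have hCi : 0 ≤ Cinf d C := by unfold Cinf; positivity
    have hK3 : 0 ≤ K3 n C := by unfold K3; positivity
    rw [← ENNReal.ofReal_add (by positivity) (by positivity), ← ENNReal.ofReal_add (by positivity) (by positivity)]
    apply ENNReal.ofReal_le_ofReal
    unfold Cst
    rw [← hβ]
    apply le_of_eq; ring
  · have ps := ((PS.simple hSrem).add (PS.sum tL fun z hz => PS.simple (hSL z hz))).add
      (PS.sum tS fun z hz => PS.simple (hSS z hz))
    refine ps.congr ?_ (Filter.EventuallyEq.refl _ _)
    have e1 : ∑ x ∈ tL, w x ≤ V * (A ^ p)⁻¹ :=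
      (Finset.sum_le_sum_of_subset_of_nonneg (Finset.filter_subset _ _) fun x _ _ => hwn x).trans hws
    have e2 : ∑ x ∈ tS, w x ≤ V * (A ^ p)⁻¹ :=
      (Finset.sum_le_sum_of_subset_of_nonneg (Finset.filter_subset _ _) fun x _ _ => hwn x).trans hws
    have hk2p : 0 ≤ K2 n C := by unfold K2; positivity
    rw [← Finset.sum_mul, ← Finset.sum_mul, ← Finset.mul_sum, ← Finset.mul_sum]
    have hAi : 0 < (A ^ p)⁻¹ := by positivity
    have f1 : β * lam * (∑ x ∈ tL, w x) * (K2 n C * K) ≤ β * K2 n C * (A * (A ^ p)⁻¹) * s := by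
      calc _ ≤ β * lam * (V * (A ^ p)⁻¹) * (K2 n C * K) := by gcongr
        _ = β * K2 n C * (A ^ p)⁻¹ * (lam * V * K) := by ring
        _ = _ := by rw [hlVK]; ring
    have f2 : β * lam * (∑ x ∈ tS, w x) * K1 n C ≤ β * K1 n C * (A * (A ^ p)⁻¹) * s := by
      calc _ ≤ β * lam * (V * (A ^ p)⁻¹) * (K1 n C * K) := by
            gcongr
            nlinarith
        _ = β * K1 n C * (A ^ p)⁻¹ * (lam * V * K) := by ring
        _ = _ := by rw [hlVK]; ring
    linarith [f1, f2]

end TolsaAux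

open MeasureTheory Metric Set Function
open scoped Classical
open scoped ENNReal NNReal BigOperators

namespace TolsaAux

variable {d : ℕ}
variable {μ : Measure (Euc d)} {n : ℕ} {C p : ℝ}

theorem exists_consts (hp : 1 < p) (N : ℕ) (β K : ℝ) (hK : 0 ≤ K) : ∃ A θ0 θ : ℝ, 1 ≤ A ∧ β ≤ A ∧ 0 < θ0 ∧ (N : ℝ) / (N + 1) ≤ θ0 ^ p ∧
    0 < θ ∧ θ < 1 ∧ θ0 + K * (A * (A ^ p)⁻¹) ≤ θ := by
  set q : ℝ := (N + 1) / (N + 2) with hq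
  have hq0 : 0 < q := by positivity
  have hq1 : q < 1 := by rw [hq, div_lt_one (by positivity)]; linarith
  have hNq : (N : ℝ) / (N + 1) ≤ q := by
    rw [hq, div_le_div_iff₀ (by positivity) (by positivity)]; nlinarith
  set θ0 := q ^ (1 / p) with hθ0
  have h0 : 0 < θ0 := by positivity
  have h1 : θ0 < 1 := Real.rpow_lt_one hq0.le hq1 (by positivity)
  have h2 : θ0 ^ p = q := by
    rw [hθ0, ← Real.rpow_mul hq0.le, one_div_mul_cancel (by linarith), Real.rpow_one]
  have ht : Filter.Tendsto (fun A : ℝ => K * A ^ (-(p - 1))) Filter.atTop (nhds (K * 0)) :=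
    (tendsto_rpow_neg_atTop (by linarith)).const_mul K
  rw [mul_zero] at ht
  have hev := ht.eventually (gt_mem_nhds (show (0 : ℝ) < (1 - θ0) / 2 by linarith))
  obtain ⟨A, hA1, hA2, hA3⟩ := (hev.and ((Filter.eventually_ge_atTop 1).and (Filter.eventually_ge_atTop β))).exists
  refine ⟨A, θ0, (1 + θ0) / 2, hA2, hA3, h0, by rw [h2]; exact hNq, by linarith, by linarith, ?_⟩
  have hA : 0 < A := by linarith
  have : A * (A ^ p)⁻¹ = A ^ (-(p - 1)) := by
    rw [show -(p - 1) = 1 - p by ring, Real.rpow_sub hA, Real.rpow_one, div_eq_mul_inv]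
  rw [this]
  linarith

theorem exists_step (d n : ℕ) (hp : 1 < p) (hC : 1 ≤ C) : ∃ θ C' : ℝ, 0 < θ ∧ θ < 1 ∧ 0 ≤ C' ∧
    ∀ μ : Measure (Euc d), Grow μ n C → CubeOf μ → ∀ s f, PS μ n p s f →
      ∃ g hh : Euc d → ℝ, (f =ᵐ[μ] fun x => g x + hh x) ∧ hatbNorm μ n g ≤ ENNReal.ofReal (C' * s) ∧
        PS μ n p (θ * s) hh := by
  obtain ⟨N, hN⟩ := covering d
  have hk1 : 0 ≤ K1 n C := by unfold K1; positivity
  have hk2 : 0 ≤ K2 n C := by unfold K2; positivity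
  have hk3 : 0 ≤ K3 n C := by unfold K3; positivity
  have hCi : 0 ≤ Cinf d C := by unfold Cinf; positivity
  obtain ⟨A, θ0, θ, hA1, hA, hθ0, hθN, hθp, hθ1, hθ⟩ :=
    exists_consts hp N (32 ^ (d + 1)) (32 ^ (d + 1) * (K1 n C + K2 n C)) (by positivity)
  have hCst : 0 ≤ Cst d n C A := by unfold Cst; positivity
  refine ⟨θ, Cst d n C A, hθp, hθ1, hCst, ?_⟩
  intro μ h Q0 s f hf
  induction hf with
  | zero => exact ⟨fun _ => 0, fun _ => 0, by simp, by rw [hatb_zero Q0]; simp, by simpa using PS.zero⟩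
  | @simple a Q D s S =>
    obtain ⟨g, hh, h1, h2, h3⟩ := h.step_simple hp hN hA hθ0 hθN S
    refine ⟨g, hh, Filter.Eventually.of_forall h1, h2, h3.congr ?_ (Filter.EventuallyEq.refl _ _)⟩
    have := mul_le_mul_of_nonneg_right hθ S.pos.le
    linarith
  | @add s t f f' hf hf' ih ih' =>
    obtain ⟨g, hh, h1, h2, h3⟩ := ih
    obtain ⟨g', hh', h1', h2', h3'⟩ := ih'
    have hs := (hf.L1 h hp).1
    have ht := (hf'.L1 h hp).1
    refine ⟨fun x => g x + g' x, fun x => hh x + hh' x, ?_, ?_, ?_⟩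
    · filter_upwards [h1, h1'] with x e1 e2
      rw [e1, e2]; ring
    · refine (hatb_add h _ _).trans ?_
      rw [mul_add, ENNReal.ofReal_add (by positivity) (by positivity)]
      exact add_le_add h2 h2'
    · rw [mul_add]; exact h3.add h3'
  | @congr s t f f' hf hst hff ih =>
    obtain ⟨g, hh, h1, h2, h3⟩ := ih
    refine ⟨g, hh, hff.symm.trans h1, h2.trans (ENNReal.ofReal_le_ofReal (by gcongr)),
      h3.congr (by gcongr) (Filter.EventuallyEq.refl _ _)⟩

theorem exists_PS (d n : ℕ) (hp : 1 < p) (hC : 1 ≤ C) : ∃ C' : ℝ, 0 ≤ C' ∧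
    ∀ μ : Measure (Euc d), Grow μ n C → CubeOf μ → ∀ s f, PS μ n p s f →
      hatbNorm μ n f ≤ ENNReal.ofReal (C' * s) := by
  obtain ⟨θ, C', hθ, hθ1, hC', hstep⟩ := exists_step (p := p) d n hp hC
  refine ⟨C' * (1 - θ)⁻¹, mul_nonneg hC' (inv_nonneg.2 (by linarith)), ?_⟩
  intro μ h Q0 s f hf
  have hs := (hf.L1 h hp).1
  choose! G H hGH using fun (s : ℝ) (f : Euc d → ℝ) (hf : PS μ n p s f) => hstep μ h Q0 s f hf
  let rest : ℕ → (Euc d → ℝ) := fun k => Nat.rec f (fun k r => H (θ ^ k * s) r) k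
  have r0 : rest 0 = f := rfl
  have rs : ∀ k, rest (k + 1) = H (θ ^ k * s) (rest k) := fun k => rfl
  have hrest : ∀ k, PS μ n p (θ ^ k * s) (rest k) := by
    intro k
    induction k with
    | zero => simpa [r0] using hf
    | succ k ih =>
      rw [rs, pow_succ', mul_assoc]
      exact (hGH _ _ ih).2.2
  let g : ℕ → (Euc d → ℝ) := fun k => G (θ ^ k * s) (rest k)
  have hg : ∀ k, rest k =ᵐ[μ] fun x => g k x + rest (k + 1) x := fun k => (hGH _ _ (hrest k)).1
  have hgh : ∀ k, hatbNorm μ n (g k) ≤ ENNReal.ofReal (C' * (θ ^ k * s)) := fun k => (hGH _ _ (hrest k)).2.1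
  have hgeo : Summable (fun k : ℕ => θ ^ k) := summable_geometric_of_lt_one hθ.le hθ1
  have hsumm : ∀ᵐ x ∂μ, Summable (fun k => |rest k x|) := by
    have hfin : ∫⁻ x, ∑' k, ‖rest k x‖ₑ ∂μ ≠ ∞ := by
      rw [lintegral_tsum fun k => ((hrest k).L1 h hp).2.1.aestronglyMeasurable.enorm]
      have hb : ∀ k, ∫⁻ x, ‖rest k x‖ₑ ∂μ ≤ ENNReal.ofReal (4 * (θ ^ k * s)) := by
        intro k
        have := (hrest k).L1 h hp
        rw [← ofReal_integral_norm_eq_lintegral_enorm this.2.1]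
        exact ENNReal.ofReal_le_ofReal this.2.2
      refine ne_top_of_le_ne_top ?_ (ENNReal.tsum_le_tsum hb)
      rw [← ENNReal.ofReal_tsum_of_nonneg (fun k => by positivity) ((hgeo.mul_right s).mul_left 4)]
      exact ENNReal.ofReal_ne_top
    have hm : AEMeasurable (fun x => ∑' k, ‖rest k x‖ₑ) μ :=
      AEMeasurable.ennreal_tsum fun k => ((hrest k).L1 h hp).2.1.aestronglyMeasurable.enorm
    filter_upwards [ae_lt_top' hm hfin] with x hx
    have := tsum_enorm_ne_top_iff_summable_norm.1 hx.ne
    exact this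
  have hsum : ∀ᵐ x ∂μ, HasSum (fun k => g k x) (f x) := by
    filter_upwards [hsumm, ae_all_iff.2 hg] with x hx he
    have hge : ∀ k, g k x = rest k x - rest (k + 1) x := fun k => by rw [he k]; ring
    have hsr : Summable (fun k => rest k x) := hx.of_abs
    have hsg : Summable (fun k => g k x) := by
      simp only [hge]
      exact hsr.sub ((summable_nat_add_iff 1).2 hsr)
    rw [hsg.hasSum_iff_tendsto_nat]
    have : ∀ m, ∑ k ∈ Finset.range m, g k x = f x - rest m x := by
      intro m
      simp only [hge]
      rw [Finset.sum_range_sub', r0]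
    simp only [this]
    simpa using hsr.tendsto_atTop_zero.const_sub (f x)
  refine (hatb_tsum h g f hsum).trans ((ENNReal.tsum_le_tsum hgh).trans ?_)
  rw [← ENNReal.ofReal_tsum_of_nonneg (fun k => by positivity) ((hgeo.mul_right s).mul_left C'), tsum_mul_left,
    tsum_mul_right, tsum_geometric_of_lt_one hθ.le hθ1, mul_assoc]

end TolsaAux

open MeasureTheory Metric Set Function
open scoped Classical
open scoped ENNReal NNReal BigOperators

namespace TolsaAux

variable {d : ℕ}
variable {μ : Measure (Euc d)} {n : ℕ} {C p : ℝ}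

theorem Grow.exists_D (h : Grow μ n C) (R : CubeOf μ) :
    ∃ D : CubeOf μ, D.c = R.c ∧ 32 * R.ℓ ≤ D.ℓ ∧ Dbl μ D.c D.ℓ ∧ Kcoef n R D ≤ K1 n C := by
  have hR := R.ℓ_pos
  have hC := h.hC
  have hex := h.exists_dbl R.c_mem R.ℓ_pos
  obtain ⟨hm1, hm2⟩ := Nat.find_spec hex
  have hmin : ∀ i, 1 ≤ i → i < Nat.find hex → ¬ Dbl μ R.c (32 ^ i * R.ℓ) :=
    fun i hi hlt hc => Nat.find_min hex hlt ⟨hi, hc⟩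
  generalize Nat.find hex = m at *
  have h32 : 32 * R.ℓ ≤ 32 ^ m * R.ℓ := by
    have : (32 : ℝ) ^ 1 ≤ 32 ^ m := pow_le_pow_right₀ (by norm_num) hm1
    rw [pow_one] at this
    gcongr
  refine ⟨⟨R.c, 32 ^ m * R.ℓ, by positivity, R.c_mem⟩, rfl, h32, hm2, ?_⟩
  refine h.K_geom (T := 32 ^ m * R.ℓ) (by positivity) ?_ le_rfl (fun r hr => h.lemG hR hmin hr)
  show R.ℓ ≤ 32 ^ m * R.ℓ
  linarith

noncomputable def Lc (n : ℕ) (C : ℝ) : ℝ := (1 + 2 * C) + 8 ^ n * (3 * C + 1) * (1 + 8 ^ n * (3 * C + 1) * K1 n C)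

noncomputable def idx (c : Euc d) (l : ℝ) (y : Euc d) : Fin d → ℤ := fun i => ⌊(y i - c i) / (l / 8)⌋

theorem idx_close {c : Euc d} {l : ℝ} (hl : 0 < l) {y z : Euc d} (he : idx c l y = idx c l z) : y ∈ cube z (l / 4) := by
  intro i
  have h1 := congrFun he i
  simp only [idx] at h1
  have h2 := Int.abs_sub_lt_one_of_floor_eq_floor h1
  rw [← sub_div, abs_div, abs_of_pos (show 0 < l / 8 by positivity), div_lt_one (by positivity)] at h2
  have : y i - c i - (z i - c i) = y i - z i := by ring
  rw [this] at h2
  linarith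

theorem idx_mem {c : Euc d} {l : ℝ} (hl : 0 < l) {y : Euc d} (hy : y ∈ cube c l) :
    idx c l y ∈ Fintype.piFinset (fun _ : Fin d => Finset.Icc (-4 : ℤ) 4) := by
  rw [Fintype.mem_piFinset]
  intro i
  have h1 := abs_le.1 (hy i)
  rw [Finset.mem_Icc]
  simp only [idx]
  constructor
  · rw [Int.le_floor, le_div_iff₀ (by positivity)]; push_cast; linarith
  · have : ⌊(y i - c i) / (l / 8)⌋ < 5 := by
      rw [Int.floor_lt, div_lt_iff₀ (by positivity)]; push_cast; linarith
    omega

theorem measurable_idx (c : Euc d) (l : ℝ) : Measurable (idx c l) := by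
  unfold idx
  refine measurable_pi_lambda _ fun i => ?_
  exact Int.measurable_floor.comp (by fun_prop)

theorem Grow.atom_PS (h : Grow μ n C) (hp : 1 < p) {Q R D : CubeOf μ} (hQR : Q.set ⊆ R.set)
    (hDc : D.c = R.c) (hDl : 32 * R.ℓ ≤ D.ℓ) (hD : Dbl μ D.c D.ℓ) (hRD : Kcoef n R D ≤ K1 n C)
    {a : Euc d → ℝ} (ha : Measurable a) (hsupp : ∀ x ∉ Q.set, a x = 0)
    (hint : Integrable (fun x => |a x| ^ p) μ) {S : ℝ} (hS : 0 < S)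
    (hb : ∫ x, |a x| ^ p ∂μ ≤ (S / (μ.real (cube Q.c (2 * Q.ℓ)) * Kcoef n Q R)) ^ p * μ.real (cube Q.c (2 * Q.ℓ))) :
    PS μ n p (9 ^ d * Lc n C * S) (Lop D a) := by
  have hd : 1 ≤ d := h.hn.trans h.hnd
  have hC := h.hC
  have hQl := Q.ℓ_pos
  have hRl := R.ℓ_pos
  have hK1p : 0 ≤ K1 n C := by unfold K1; positivity
  have hLp : 0 < Lc n C := by unfold Lc; positivity
  have hQRl : Q.ℓ ≤ R.ℓ := side_le_of_subset hd hQl.le hQR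
  have hQcR : Q.c ∈ cube R.c R.ℓ := hQR (mem_cube_self _ hQl.le)
  set κ := Kcoef n Q R with hκ
  have hκ1 : 1 ≤ κ := one_le_K Q R
  set W := μ.real (cube Q.c (2 * Q.ℓ)) with hW
  have hWp : 0 < W := h.pos Q.c_mem (by positivity)
  have hQD : Kcoef n Q D ≤ (1 + 8 ^ n * (3 * C + 1) * K1 n C) * κ := by
    have t1 := h.K_triangle (Q' := Q) (Q := R) (D := D) hQcR (by linarith)
    have t2 : 8 ^ n * (3 * C + 1) * Kcoef n R D ≤ 8 ^ n * (3 * C + 1) * K1 n C := by gcongr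
    have t3 : 0 ≤ 8 ^ n * (3 * C + 1) * K1 n C := by positivity
    rw [← hκ] at t1
    nlinarith
  have hai : Integrable a μ := by
    have h1 : IntegrableOn a Q.set μ := absInt hp ha hint.integrableOn (h.fin _ _)
    have hQm : MeasurableSet Q.set := measurableSet_cube _ _
    rw [← integrable_indicator_iff hQm] at h1
    refine h1.congr (Filter.Eventually.of_forall fun y => ?_)
    by_cases hy : y ∈ Q.set
    · rw [indicator_of_mem hy]
    · rw [indicator_of_notMem hy, hsupp y hy]
  set T := Fintype.piFinset (fun _ : Fin d => Finset.Icc (-4 : ℤ) 4) with hT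
  have hTc : T.card = 9 ^ d := by simp [hT]
  let cell : (Fin d → ℤ) → Set (Euc d) := fun k => Q.set ∩ (idx Q.c Q.ℓ) ⁻¹' {k}
  have hcm : ∀ k, MeasurableSet (cell k) := fun k =>
    (measurableSet_cube Q.c Q.ℓ).inter ((measurable_idx Q.c Q.ℓ) (measurableSet_singleton k))
  have hdec : a = fun y => ∑ k ∈ T, indicator (cell k) a y := by
    ext y
    by_cases hy : y ∈ Q.set
    · rw [Finset.sum_eq_single (idx Q.c Q.ℓ y)]
      · rw [indicator_of_mem]; exact ⟨hy, rfl⟩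
      · intro k _ hk
        rw [indicator_of_notMem]
        exact fun hc => hk hc.2.symm
      · intro hc; exact absurd (idx_mem hQl hy) hc
    · rw [hsupp y hy, Finset.sum_eq_zero]
      intro k _
      rw [indicator_of_notMem]
      exact fun hc => hy hc.1
  have hci : ∀ k, Integrable (indicator (cell k) a) μ := fun k => hai.indicator (hcm k)
  have hcell : ∀ k ∈ T, PS μ n p (Lc n C * S) (Lop D (indicator (cell k) a)) := by
    intro k _
    by_cases hne : (cell k ∩ measSupp μ).Nonempty
    · obtain ⟨z, ⟨hzQ, hzk⟩, hzs⟩ := hne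
      set q : CubeOf μ := ⟨z, Q.ℓ / 4, by positivity, hzs⟩ with hq
      have hqc : cube q.c (4 * q.ℓ) = cube z Q.ℓ := by
        show cube z (4 * (Q.ℓ / 4)) = _
        congr 1; ring
      refine PS.simple (Q := q) ⟨ha.indicator (hcm k), ?_, ?_, hD, ?_, by positivity, ?_⟩
      · intro x hx
        rw [indicator_of_notMem]
        rintro ⟨_, hc⟩
        exact hx (idx_close hQl (hc.trans hzk.symm))
      · rw [indicator_rpow hp]; exact hint.indicator (hcm k)
      · show cube z (2 * (Q.ℓ / 4)) ⊆ cube D.c D.ℓ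
        rw [hDc]
        refine (cube_subset (t' := 2 * Q.ℓ) hzQ (by linarith)).trans (cube_subset hQcR (by linarith))
      · rw [indicator_rpow hp, integral_indicator (hcm k), hqc]
        set V := μ.real (cube z Q.ℓ) with hV
        have hVp : 0 < V := h.pos hzs hQl
        have hVW : V ≤ W := h.mono_real (cube_subset hzQ (by linarith))
        set Kq := Kcoef n q D with hKq
        have hKq1 : 1 ≤ Kq := one_le_K q D
        have hKqb : Kq ≤ Lc n C * κ := by
          have t1 := h.K_triangle (Q' := q) (Q := Q) (D := D) hzQ (by show Q.ℓ / 4 ≤ _; linarith)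
          have t2 : Kcoef n q Q ≤ 1 + 2 * C := h.K_comparable (by show Q.ℓ ≤ 4 * (Q.ℓ / 4); linarith)
          have t3 : 8 ^ n * (3 * C + 1) * Kcoef n Q D ≤ 8 ^ n * (3 * C + 1) * ((1 + 8 ^ n * (3 * C + 1) * K1 n C) * κ) := by gcongr
          have t4 : 1 + 2 * C ≤ (1 + 2 * C) * κ := le_mul_of_one_le_right (by positivity) hκ1
          unfold Lc
          linarith
        refine (setIntegral_le_integral hint (Filter.Eventually.of_forall fun x => by positivity)).trans (hb.trans ?_)
        have e1 : S / (W * κ) * (W / V) ≤ Lc n C * S / (V * Kq) := by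
          rw [le_div_iff₀ (by positivity)]
          have : S / (W * κ) * (W / V) * (V * Kq) = S * Kq / κ := by field_simp
          rw [this, div_le_iff₀ (by positivity)]
          nlinarith
        have e2 : W / V ≤ (W / V) ^ p := Real.self_le_rpow_of_one_le ((one_le_div hVp).2 hVW) hp.le
        calc (S / (W * κ)) ^ p * W = (S / (W * κ)) ^ p * (W / V) * V := by field_simp
          _ ≤ (S / (W * κ)) ^ p * (W / V) ^ p * V := by gcongr
          _ = (S / (W * κ) * (W / V)) ^ p * V := by rw [Real.mul_rpow (by positivity) (by positivity)]
          _ ≤ _ := by gcongr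
    · have hnull : indicator (cell k) a =ᵐ[μ] fun _ => 0 := by
        filter_upwards [h.ae_small] with x hx
        rw [indicator_of_notMem]
        exact fun hc => hne ⟨x, hc, hx.1⟩
      refine PS.zero.congr (by positivity) ?_
      filter_upwards [hnull] with x hx
      simp only [Lop]
      rw [hx, integral_congr_ae hnull]; simp
  have hps := PS.sum T hcell
  refine hps.congr ?_ (Filter.Eventually.of_forall fun x => ?_)
  · rw [Finset.sum_const, hTc]; simp; apply le_of_eq; ring
  · show _ = Lop D a x
    conv_rhs => rw [hdec]
    rw [Lop_sum T (fun k _ => hci k)]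

end TolsaAux

open MeasureTheory Metric Set Function
open scoped Classical
open scoped ENNReal NNReal BigOperators

namespace TolsaAux

variable {d : ℕ}
variable {μ : Measure (Euc d)} {n : ℕ} {C p : ℝ}

theorem Grow.atom_real (h : Grow μ n C) (hp : 1 < p) {a0 : Euc d → ℝ} {Q : CubeOf μ} {κ : ℝ} (hκ : 1 ≤ κ)
    (hm : AEStronglyMeasurable a0 μ) (hs : ∀ x ∉ Q.set, a0 x = 0)
    (hb : eLpNorm a0 (ENNReal.ofReal p) μ ≤ μ (Q.dil 2) ^ (1 / p - 1) * (ENNReal.ofReal κ)⁻¹) :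
    ∃ a : Euc d → ℝ, Measurable a ∧ a0 =ᵐ[μ] a ∧ (∀ x ∉ Q.set, a x = 0) ∧ Integrable (fun x => |a x| ^ p) μ ∧
      ∫ x, |a x| ^ p ∂μ ≤ (1 / (μ.real (cube Q.c (2 * Q.ℓ)) * κ)) ^ p * μ.real (cube Q.c (2 * Q.ℓ)) := by
  have hQm : MeasurableSet Q.set := measurableSet_cube _ _
  have hQl := Q.ℓ_pos
  have hp0 : 0 < p := by linarith
  have hsm := hm.stronglyMeasurable_mk
  set a : Euc d → ℝ := indicator Q.set (hm.mk a0) with ha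
  have hae : a0 =ᵐ[μ] a := by
    filter_upwards [hm.ae_eq_mk] with x hx
    by_cases hxQ : x ∈ Q.set
    · rw [ha, indicator_of_mem hxQ, hx]
    · rw [ha, indicator_of_notMem hxQ, hs x hxQ]
  have hma : Measurable a := hsm.measurable.indicator hQm
  set W := μ.real (cube Q.c (2 * Q.ℓ)) with hW
  have hWp : 0 < W := h.pos Q.c_mem (by positivity)
  have hWe : μ (Q.dil 2) = ENNReal.ofReal W := (ENNReal.ofReal_toReal (h.fin _ _)).symm
  rw [eLpNorm_congr_ae hae, hWe, ENNReal.ofReal_rpow_of_pos hWp, ← ENNReal.ofReal_inv_of_pos (by linarith),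
    ← ENNReal.ofReal_mul (by positivity)] at hb
  have hML : MemLp a (ENNReal.ofReal p) μ := ⟨hma.aestronglyMeasurable, hb.trans_lt ENNReal.ofReal_lt_top⟩
  have hpe : (ENNReal.ofReal p) ≠ 0 := by simpa using hp0
  have hint : Integrable (fun x => |a x| ^ p) μ := by
    have := hML.integrable_norm_rpow hpe ENNReal.ofReal_ne_top
    simpa [ENNReal.toReal_ofReal hp0.le] using this
  refine ⟨a, hma, hae, fun x hx => indicator_of_notMem hx _, hint, ?_⟩
  rw [hML.eLpNorm_eq_integral_rpow_norm hpe ENNReal.ofReal_ne_top, ENNReal.toReal_ofReal hp0.le,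
    ENNReal.ofReal_le_ofReal_iff (by positivity)] at hb
  have hI : 0 ≤ ∫ x, |a x| ^ p ∂μ := integral_nonneg fun x => by positivity
  have h1 : ((∫ x, |a x| ^ p ∂μ) ^ p⁻¹) ^ p ≤ (W ^ (1 / p - 1) * κ⁻¹) ^ p :=
    Real.rpow_le_rpow (by positivity) hb hp0.le
  rw [← Real.rpow_mul hI, inv_mul_cancel₀ hp0.ne', Real.rpow_one] at h1
  refine h1.trans (le_of_eq ?_)
  have h2 : W ^ (1 / p - 1) * κ⁻¹ = (1 / (W * κ)) * W ^ (1 / p) := by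
    rw [Real.rpow_sub hWp, Real.rpow_one]; field_simp
  rw [h2, Real.mul_rpow (by positivity) (by positivity), ← Real.rpow_mul hWp.le, one_div_mul_cancel hp0.ne',
    Real.rpow_one]

theorem Grow.block_le (h : Grow μ n C) (hp : 1 < p) {C' : ℝ} (hC' : 0 ≤ C')
    (hPS : ∀ s f, PS μ n p s f → hatbNorm μ n f ≤ ENNReal.ofReal (C' * s)) (B : PAtomicBlock μ n p) :
    hatbNorm μ n B.b ≤ ENNReal.ofReal (C' * (9 ^ d * Lc n C)) * ENNReal.ofReal B.size := by
  have hC := h.hC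
  have hp0 : 0 < p := by linarith
  have hK1p : 0 ≤ K1 n C := by unfold K1; positivity
  have hLp : 0 ≤ Lc n C := by unfold Lc; positivity
  obtain ⟨D, hDc, hDl, hD, hRD⟩ := h.exists_D B.R
  have hat := fun j => h.atom_real hp (one_le_K (n := n) (B.Qj j) B.R) (B.a_meas j) (B.a_supp j) (B.a_bound j)
  choose a hma hae hsa hia hba using hat
  have hai : ∀ j, Integrable (a j) μ ∧ ∫ x, |a j x| ∂μ ≤ 2 := by
    intro j
    have hQm : MeasurableSet (B.Qj j).set := measurableSet_cube _ _
    have hQl := (B.Qj j).ℓ_pos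
    have h1 : IntegrableOn (a j) (B.Qj j).set μ := absInt hp (hma j) (hia j).integrableOn (h.fin _ _)
    refine ⟨?_, ?_⟩
    · rw [← integrable_indicator_iff hQm] at h1
      refine h1.congr (Filter.Eventually.of_forall fun y => ?_)
      by_cases hy : y ∈ (B.Qj j).set
      · rw [indicator_of_mem hy]
      · rw [indicator_of_notMem hy, hsa j y hy]
    · have e : ∫ x, |a j x| ∂μ = ∫ x in (B.Qj j).set, |a j x| ∂μ := by
        rw [setIntegral_eq_integral_of_forall_compl_eq_zero]
        intro x hx; rw [hsa j x hx, abs_zero]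
      have hb := hba j
      set W := μ.real (cube (B.Qj j).c (2 * (B.Qj j).ℓ)) with hW
      have hWp : 0 < W := h.pos (B.Qj j).c_mem (by positivity)
      have hκ := one_le_K (n := n) (B.Qj j) B.R
      set κ := Kcoef n (B.Qj j) B.R with hκe
      have hu : 0 < 1 / (W * κ) := by positivity
      have h2 := absInt_le hp (hma j) (E := (B.Qj j).set) (hia j).integrableOn (h.fin _ _) hu
      have h3 : ∫ x in (B.Qj j).set, |a j x| ^ p ∂μ ≤ (1 / (W * κ)) ^ p * W :=
        (setIntegral_le_integral (hia j) (Filter.Eventually.of_forall fun x => by positivity)).trans hb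
      have h4 : μ.real (B.Qj j).set ≤ W := h.mono_real (cube_mono _ (by linarith))
      rw [e]
      calc _ ≤ _ := h2
        _ ≤ (1 / (W * κ)) * (W + W) := by
            gcongr
            rw [div_le_iff₀ (by positivity)]
            linarith
        _ = 2 / κ := by field_simp; ring
        _ ≤ 2 := div_le_self (by norm_num) hκ
  have hint : HasSum (fun j => ∫ x, B.lam j * a j x ∂μ) 0 := by
    have h1 := hasSum_integral_of_summable_integral_norm (μ := μ) (F := fun j x => B.lam j * a j x)
      (fun j => (hai j).1.const_mul _) (by
        refine Summable.of_nonneg_of_le (fun j => integral_nonneg fun x => norm_nonneg _) (fun j => ?_)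
          (B.lam_summable.mul_right 2)
        simp only [norm_mul, Real.norm_eq_abs]
        rw [integral_const_mul]
        exact mul_le_mul_of_nonneg_left (hai j).2 (abs_nonneg _))
    have h2 : ∫ x, ∑' j, B.lam j * a j x ∂μ = 0 := by
      rw [← B.int_zero]
      refine integral_congr_ae ?_
      filter_upwards [B.b_eq, ae_all_iff.2 hae] with x hx hx2
      rw [← hx.tsum_eq]
      exact tsum_congr fun j => by rw [hx2 j]
    rwa [h2] at h1
  have hsum : ∀ᵐ x ∂μ, HasSum (fun j => Lop D (fun y => B.lam j * a j y) x) (B.b x) := by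
    filter_upwards [B.b_eq, ae_all_iff.2 hae] with x hx hx2
    have h1 : HasSum (fun j => B.lam j * a j x) (B.b x) := by
      refine hx.congr_fun ?_
      intro j; rw [hx2 j]
    have h2 := h1.sub ((hint.div_const (μ.real D.set)).mul_right (indicator D.set (fun _ => (1 : ℝ)) x))
    simpa [Lop] using h2
  have hj : ∀ j, hatbNorm μ n (Lop D (fun y => B.lam j * a j y)) ≤ ENNReal.ofReal (C' * (9 ^ d * Lc n C) * |B.lam j|) := by
    intro j
    by_cases hl : B.lam j = 0
    · have : Lop D (fun y => B.lam j * a j y) = fun _ => 0 := by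
        ext x; simp [Lop, hl]
      rw [this, hatb_zero D]; exact zero_le
    · have hlp : 0 < |B.lam j| := abs_pos.2 hl
      have e0 : (fun x => |B.lam j * a j x| ^ p) = fun x => |B.lam j| ^ p * |a j x| ^ p := by
        ext x; rw [abs_mul, Real.mul_rpow (abs_nonneg _) (abs_nonneg _)]
      have := h.atom_PS hp (B.Qj_sub j) hDc hDl hD hRD (a := fun y => B.lam j * a j y) (S := |B.lam j|)
        ((hma j).const_mul _) (fun x hx => by rw [hsa j x hx, mul_zero])
        (by rw [e0]; exact (hia j).const_mul _) hlp (by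
          rw [e0, integral_const_mul, ← mul_one_div |B.lam j|, Real.mul_rpow (abs_nonneg _) (by
            have := one_le_K (n := n) (B.Qj j) B.R
            positivity), mul_assoc]
          exact mul_le_mul_of_nonneg_left (hba j) (by positivity))
      refine (hPS _ _ this).trans (le_of_eq ?_)
      congr 1; ring
  refine (hatb_tsum h _ _ hsum).trans ((ENNReal.tsum_le_tsum hj).trans (le_of_eq ?_))
  rw [PAtomicBlock.size, ← ENNReal.ofReal_mul (by positivity), ← tsum_mul_left, ENNReal.ofReal_tsum_of_nonneg
    (fun j => by positivity) (B.lam_summable.mul_left _)]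

theorem exists_hard (d n : ℕ) (hp : 1 < p) (hC : 1 ≤ C) : ∃ C' : ℝ, 0 ≤ C' ∧
    ∀ μ : Measure (Euc d), Grow μ n C → ∀ f, hatbNorm μ n f ≤ ENNReal.ofReal C' * hatbPNorm μ n p f := by
  obtain ⟨C', hC', hPS⟩ := exists_PS (p := p) d n hp hC
  have hK1p : 0 ≤ K1 n C := by unfold K1; positivity
  have hLp : 0 < Lc n C := by unfold Lc; positivity
  refine ⟨C' * (9 ^ d * Lc n C) + 1, by positivity, fun μ h f => ?_⟩
  have hc0 : ENNReal.ofReal (C' * (9 ^ d * Lc n C) + 1) ≠ 0 := by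
    simp only [ne_eq, ENNReal.ofReal_eq_zero, not_le]; positivity
  rw [← ENNReal.div_le_iff' hc0 ENNReal.ofReal_ne_top]
  refine le_sInf ?_
  rintro t ⟨B, hB, rfl⟩
  rw [ENNReal.div_le_iff' hc0 ENNReal.ofReal_ne_top]
  refine (hatb_tsum h _ _ hB).trans ?_
  rw [← ENNReal.tsum_mul_left]
  refine ENNReal.tsum_le_tsum fun i => ?_
  refine (h.block_le hp hC' (hPS μ h (B i).R) (B i)).trans ?_
  gcongr
  linarith

theorem Grow.atom_conv (h : Grow μ n C) (hp : 1 < p) {a : Euc d → ℝ} {Q : CubeOf μ} {κ : ℝ} (hκ : 1 ≤ κ)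
    (hm : AEStronglyMeasurable a μ) (hs : ∀ x ∉ Q.set, a x = 0)
    (hb : eLpNorm a ⊤ μ ≤ (μ (Q.dil 2) * ENNReal.ofReal κ)⁻¹) :
    eLpNorm a (ENNReal.ofReal p) μ ≤ μ (Q.dil 2) ^ (1 / p - 1) * (ENNReal.ofReal κ)⁻¹ := by
  have hQm : MeasurableSet Q.set := measurableSet_cube _ _
  have hQl := Q.ℓ_pos
  have hp0 : 0 < p := by linarith
  have hsub : Function.support a ⊆ Q.set := by
    intro x hx
    by_contra hc
    exact hx (hs x hc)
  have h1 := eLpNorm_le_eLpNorm_mul_rpow_measure_univ (μ := μ.restrict Q.set) (f := a)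
    (p := ENNReal.ofReal p) (q := ⊤) le_top hm.restrict
  rw [eLpNorm_restrict_eq_of_support_subset hsub, eLpNorm_restrict_eq_of_support_subset hsub,
    Measure.restrict_apply_univ, ENNReal.toReal_ofReal hp0.le] at h1
  simp only [ENNReal.toReal_top, div_zero, sub_zero] at h1
  have h2 : μ Q.set ≤ μ (Q.dil 2) := measure_mono (cube_mono _ (by linarith))
  have hWp : 0 < μ.real (cube Q.c (2 * Q.ℓ)) := h.pos Q.c_mem (by positivity)
  set W := μ.real (cube Q.c (2 * Q.ℓ)) with hW
  have hWe : μ (Q.dil 2) = ENNReal.ofReal W := (ENNReal.ofReal_toReal (h.fin _ _)).symm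
  calc _ ≤ _ := h1
    _ ≤ (μ (Q.dil 2) * ENNReal.ofReal κ)⁻¹ * μ (Q.dil 2) ^ (1 / p) := by gcongr
    _ = _ := by
      rw [hWe, ENNReal.ofReal_rpow_of_pos hWp, ENNReal.ofReal_rpow_of_pos hWp, ← ENNReal.ofReal_inv_of_pos (by linarith),
        ← ENNReal.ofReal_mul (by positivity), ← ENNReal.ofReal_mul (by positivity),
        ← ENNReal.ofReal_inv_of_pos (by positivity), ← ENNReal.ofReal_mul (by positivity)]
      congr 1
      rw [Real.rpow_sub hWp, Real.rpow_one]
      field_simp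

noncomputable def Grow.conv (h : Grow μ n C) (hp : 1 < p) (B : AtomicBlock μ n) : PAtomicBlock μ n p where
  b := B.b
  R := B.R
  lam := B.lam
  a := B.a
  Qj := B.Qj
  integrable := B.integrable
  supp_b := B.supp_b
  int_zero := B.int_zero
  Qj_sub := B.Qj_sub
  a_supp := B.a_supp
  a_meas := B.a_meas
  a_bound := fun j => h.atom_conv hp (one_le_K _ _) (B.a_meas j) (B.a_supp j) (B.a_bound j)
  lam_summable := B.lam_summable
  b_eq := B.b_eq

theorem Grow.easy (h : Grow μ n C) (hp : 1 < p) (f : Euc d → ℝ) : hatbPNorm μ n p f ≤ hatbNorm μ n f := by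
  refine le_sInf ?_
  rintro t ⟨B, hB, rfl⟩
  exact sInf_le ⟨fun i => h.conv hp (B i), hB, rfl⟩

end TolsaAux

/-- Theorem 5.5 (part): for `1 < p < ∞`, `H^{1,p}_atb(μ) = H^{1,∞}_atb(μ)` with
equivalent norms. -/
theorem statement12 (d n : ℕ) (hn : 1 ≤ n) (hnd : n ≤ d) (C₀ βd p : ℝ)
    (hC₀ : 0 < C₀) (hβ : (2 : ℝ) ^ n < βd) (hp : 1 < p) :
    ∃ C : ℝ, 1 ≤ C ∧ ∀ μ : MeasureTheory.Measure (Euc d), GrowthBound μ n C₀ →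
      SmallDoublingAE μ βd →
      ∀ f : Euc d → ℝ, MeasureTheory.Integrable f μ →
        hatbNorm μ n f ≤ ENNReal.ofReal C * hatbPNorm μ n p f ∧
        hatbPNorm μ n p f ≤ ENNReal.ofReal C * hatbNorm μ n f := by
  obtain ⟨C', hC', hmain⟩ := TolsaAux.exists_hard (p := p) (C := C₀ * d ^ n + 1) d n hp
    (by have : 0 ≤ C₀ * (d : ℝ) ^ n := by positivity
        linarith)
  refine ⟨C' + 1, by linarith, ?_⟩
  intro μ hg _ f _
  have h := TolsaAux.Grow.of_growthBound hn hnd hC₀ hg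
  refine ⟨(hmain μ h f).trans (by gcongr; linarith), (h.easy hp f).trans ?_⟩
  refine le_mul_of_one_le_left zero_le ?_
  rw [ENNReal.one_le_ofReal]; linarith
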